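/- arXiv:2010.01341 — 3 statements merged into one kernel-verified Lean document; each statement's English description precedes it below -/
import Mathlib

section
/- Let n ≥ 1. There exists C > 0 such that for every measurable g : ℝⁿ → [0,∞], ∫_{ℝⁿ} [ sup_{r>0} γ₋₁(B(x,r))^{−1} ∫_{B(x,r)} g(y) χ_{N^c}(x,y) γ₋₁(y) dy ] γ₋₁(x) dx ≤ C ∫_{ℝⁿ} g(y) γ₋₁(y) dy; that is, the global part of the centered Hardy–Littlewood maximal operator with respect to γ₋₁ is bounded on L¹(ℝⁿ, γ₋₁). -/
open MeasureTheory Real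
open scoped ENNReal

/-- The inverse Gaussian measure `γ₋₁` on `ℝⁿ`, with density `π^{n/2} e^{|x|²}`
with respect to Lebesgue measure. -/
noncomputable def gammaM1 (n : ℕ) : Measure (EuclideanSpace ℝ (Fin n)) :=
  volume.withDensity fun x => ENNReal.ofReal (Real.pi ^ ((n : ℝ) / 2) * Real.exp (‖x‖ ^ 2))

/-- The local region `N = {(x,y) : |x-y| ≤ min(1, 1/|x|)}`. -/
def localN (n : ℕ) : Set (EuclideanSpace ℝ (Fin n) × EuclideanSpace ℝ (Fin n)) :=
  {p | ‖p.1 - p.2‖ ≤ 1 ∧ ‖p.1 - p.2‖ * ‖p.1‖ ≤ 1}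

theorem exp_neg_le_factorial_div_pow {s : ℝ} (hs : 0 < s) (k : ℕ) :
    Real.exp (-s) ≤ k.factorial * (s ^ k)⁻¹ := by
  have h := Real.pow_div_factorial_le_exp s hs.le k
  rw [Real.exp_neg, ← div_eq_mul_inv, inv_le_comm₀ (Real.exp_pos _) (by positivity), inv_div]
  exact h

/-- The radial profile at scale `1 / M` of an `L¹`-normalised, polynomially decaying kernel. -/
noncomputable def decayProfile (n : ℕ) (M r : ℝ) : ℝ := M ^ n * ((1 + M * r) ^ (n + 1))⁻¹

theorem decayProfile_nonneg (n : ℕ) {M r : ℝ} (hM : 0 ≤ M) (hr : 0 ≤ r) :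
    0 ≤ decayProfile n M r := by
  unfold decayProfile; positivity

theorem pow_mul_exp_sq_sub_sq_le_of_one_le (n : ℕ) {a r : ℝ} (ha : 0 ≤ a) (hr : 1 ≤ r) :
    (a + r) ^ n * Real.exp (a ^ 2 - (a + r) ^ 2) ≤
      (2 * n + 1).factorial * 2 ^ (n + 1) * decayProfile n 1 r := by
  have hr0 : 0 < r := by linarith
  set s := r * (2 * a + r) with hs
  have has : a + r ≤ s := by nlinarith
  have hrs : r ≤ s := by linarith
  have hs0 : 0 < s := by linarith
  have hexp : a ^ 2 - (a + r) ^ 2 = -s := by rw [hs]; ring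
  have hkey : (s ^ (n + 1))⁻¹ ≤ 2 ^ (n + 1) * ((1 + r) ^ (n + 1))⁻¹ := by
    rw [← inv_pow, ← inv_pow, ← mul_pow]
    gcongr
    rw [← div_eq_mul_inv, inv_le_comm₀ hs0 (by positivity), inv_div]
    linarith
  calc (a + r) ^ n * Real.exp (a ^ 2 - (a + r) ^ 2)
      ≤ s ^ n * ((2 * n + 1).factorial * (s ^ (2 * n + 1))⁻¹) := by
        rw [hexp]
        gcongr
        exact exp_neg_le_factorial_div_pow hs0 _
    _ = (2 * n + 1).factorial * (s ^ (n + 1))⁻¹ := by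
        rw [show 2 * n + 1 = n + (n + 1) by ring, pow_add s n (n + 1)]
        field_simp
    _ ≤ (2 * n + 1).factorial * (2 ^ (n + 1) * ((1 + r) ^ (n + 1))⁻¹) := by gcongr
    _ = _ := by simp [decayProfile, mul_assoc]

theorem pow_mul_exp_sq_sub_sq_le_of_le_one (n : ℕ) {a b r : ℝ} (ha : 0 ≤ a) (hb : 0 ≤ b)
    (hr0 : 0 ≤ r) (hr : r ≤ 1) (hab : a ≤ b + r) (hba : b ≤ a + r) :
    (a + r) ^ n * Real.exp (a ^ 2 - (a + r) ^ 2) ≤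
      Real.exp 3 * (n + 1).factorial * decayProfile n (b + 2) r := by
  have hexp : a ^ 2 - (a + r) ^ 2 ≤ 3 + -(1 + (b + 2) * r) := by nlinarith
  calc (a + r) ^ n * Real.exp (a ^ 2 - (a + r) ^ 2)
      ≤ (b + 2) ^ n * (Real.exp 3 * ((n + 1).factorial * ((1 + (b + 2) * r) ^ (n + 1))⁻¹)) := by
        have hbase : a + r ≤ b + 2 := by linarith
        gcongr ?_ ^ n * ?_
        · refine (Real.exp_le_exp.2 hexp).trans ?_
          rw [Real.exp_add]
          gcongr
          exact exp_neg_le_factorial_div_pow (by positivity) _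
    _ = _ := by unfold decayProfile; ring

theorem pow_mul_exp_sq_sub_sq_le (n : ℕ) {a b r : ℝ} (ha : 0 ≤ a) (hb : 0 ≤ b)
    (hr0 : 0 ≤ r) (hab : a ≤ b + r) (hba : b ≤ a + r) :
    (a + r) ^ n * Real.exp (a ^ 2 - (a + r) ^ 2) ≤
      ((2 * n + 1).factorial * 2 ^ (n + 1) + Real.exp 3 * (n + 1).factorial) *
        (decayProfile n 1 r + decayProfile n (b + 2) r) := by
  have h1 := decayProfile_nonneg n zero_le_one hr0
  have h2 := decayProfile_nonneg n (by linarith : 0 ≤ b + 2) hr0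
  have c1 : (0 : ℝ) ≤ (2 * n + 1).factorial * 2 ^ (n + 1) := by positivity
  have c2 : (0 : ℝ) ≤ Real.exp 3 * (n + 1).factorial := by positivity
  rcases le_total 1 r with hr | hr
  · refine (pow_mul_exp_sq_sub_sq_le_of_one_le n ha hr).trans ?_
    gcongr <;> linarith
  · refine (pow_mul_exp_sq_sub_sq_le_of_le_one n ha hb hr0 hr hab hba).trans ?_
    gcongr <;> linarith

theorem lintegral_decayProfile (n : ℕ) {M : ℝ} (hM : 0 < M) (y : EuclideanSpace ℝ (Fin n)) :
    ∫⁻ x : EuclideanSpace ℝ (Fin n), ENNReal.ofReal (decayProfile n M ‖x - y‖) =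
      ∫⁻ x : EuclideanSpace ℝ (Fin n), ENNReal.ofReal (((1 + ‖x‖) ^ (n + 1))⁻¹) := by
  have hmeas : Measurable fun x : EuclideanSpace ℝ (Fin n) =>
      ENNReal.ofReal (((1 + ‖x‖) ^ (n + 1))⁻¹) := by fun_prop
  have hmap := Measure.map_addHaar_smul (volume : Measure (EuclideanSpace ℝ (Fin n))) hM.ne'
  have hint : ∫⁻ x : EuclideanSpace ℝ (Fin n), ENNReal.ofReal (((1 + ‖M • x‖) ^ (n + 1))⁻¹) =
      ENNReal.ofReal (M ^ n)⁻¹ *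
        ∫⁻ x : EuclideanSpace ℝ (Fin n), ENNReal.ofReal (((1 + ‖x‖) ^ (n + 1))⁻¹) := by
    rw [← lintegral_map hmeas (measurable_const_smul M), hmap, lintegral_smul_measure,
      finrank_euclideanSpace_fin, abs_of_pos (by positivity), smul_eq_mul]
  rw [lintegral_sub_right_eq_self
    (fun x : EuclideanSpace ℝ (Fin n) => ENNReal.ofReal (decayProfile n M ‖x‖)) y]
  have hprof : ∀ x : EuclideanSpace ℝ (Fin n), ENNReal.ofReal (decayProfile n M ‖x‖) =
      ENNReal.ofReal (M ^ n) * ENNReal.ofReal (((1 + ‖M • x‖) ^ (n + 1))⁻¹) := fun x => by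
    rw [decayProfile, ENNReal.ofReal_mul (by positivity), norm_smul, Real.norm_of_nonneg hM.le]
  simp_rw [hprof]
  rw [lintegral_const_mul _ (by fun_prop), hint, ← mul_assoc, ← ENNReal.ofReal_mul (by positivity),
    mul_inv_cancel₀ (by positivity), ENNReal.ofReal_one, one_mul]

theorem lintegral_inv_one_add_norm_pow_lt_top (n : ℕ) :
    ∫⁻ x : EuclideanSpace ℝ (Fin n), ENNReal.ofReal (((1 + ‖x‖) ^ (n + 1))⁻¹) < ∞ := by
  have h := finite_integral_one_add_norm (E := EuclideanSpace ℝ (Fin n)) (μ := volume)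
    (r := ((n + 1 : ℕ) : ℝ)) (by rw [finrank_euclideanSpace_fin]; push_cast; linarith)
  refine lt_of_eq_of_lt (lintegral_congr fun x => ?_) h
  rw [Real.rpow_neg (by positivity), Real.rpow_natCast]

theorem exists_norm_eq_one_eq_norm_smul {n : ℕ} (hn : 1 ≤ n) (x : EuclideanSpace ℝ (Fin n)) :
    ∃ u : EuclideanSpace ℝ (Fin n), ‖u‖ = 1 ∧ x = ‖x‖ • u := by
  by_cases hx : x = 0
  · refine ⟨EuclideanSpace.single ⟨0, hn⟩ 1, by simp, by simp [hx]⟩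
  · refine ⟨‖x‖⁻¹ • x, norm_smul_inv_norm (𝕜 := ℝ) hx, ?_⟩
    rw [smul_smul, mul_inv_cancel₀ (norm_ne_zero_iff.2 hx), one_smul]

theorem ofReal_mul_volume_ball_le_gammaM1_ball {n : ℕ} {z : EuclideanSpace ℝ (Fin n)} {ρ t : ℝ}
    (h : ∀ w ∈ Metric.ball z ρ, t ≤ ‖w‖ ^ 2) :
    ENNReal.ofReal (Real.pi ^ ((n : ℝ) / 2) * Real.exp t) * volume (Metric.ball z ρ) ≤
      gammaM1 n (Metric.ball z ρ) := by
  rw [gammaM1, withDensity_apply _ Metric.isOpen_ball.measurableSet, ← setLIntegral_const]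
  refine setLIntegral_mono' Metric.isOpen_ball.measurableSet fun w hw => ?_
  have := h w hw
  gcongr

theorem le_gammaM1_ball {n : ℕ} (hn : 1 ≤ n) (x : EuclideanSpace ℝ (Fin n)) {r : ℝ}
    (hr : 0 < r) (hR : 1 ≤ r * (‖x‖ + r)) :
    ENNReal.ofReal (Real.pi ^ ((n : ℝ) / 2) * Real.exp ((‖x‖ + r) ^ 2 - 2) *
      ((2 * (‖x‖ + r))⁻¹ ^ n *
        (volume (Metric.ball (0 : EuclideanSpace ℝ (Fin n)) 1)).toReal)) ≤
      gammaM1 n (Metric.ball x r) := by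
  obtain ⟨u, hu, hxu⟩ := exists_norm_eq_one_eq_norm_smul hn x
  set R := ‖x‖ + r with hRdef
  have hRr : r ≤ R := by linarith [norm_nonneg x]
  have hR0 : 0 < R := by linarith
  set ρ := (2 * R)⁻¹ with hρ
  have hρ0 : 0 < ρ := by positivity
  have hρR : 2 * ρ * R = 1 := by rw [hρ]; field_simp
  have hρr : 2 * ρ ≤ r := by nlinarith
  set z := (‖x‖ + (r - ρ)) • u with hz
  have hdist : dist z x = r - ρ := by
    have : z - x = (r - ρ) • u := by rw [hz, add_smul, ← hxu]; abel
    rw [dist_eq_norm, this, norm_smul, hu, mul_one, Real.norm_of_nonneg (by linarith)]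
  have hznorm : ‖z‖ = R - ρ := by
    rw [hz, norm_smul, hu, mul_one, Real.norm_of_nonneg (by linarith [norm_nonneg x])]
    ring
  have hnorm : ∀ w ∈ Metric.ball z ρ, R ^ 2 - 2 ≤ ‖w‖ ^ 2 := fun w hw => by
    have h1 : ‖z‖ - ‖w‖ ≤ ‖z - w‖ := norm_sub_norm_le z w
    rw [← dist_eq_norm, dist_comm] at h1
    have h2 : R - 2 * ρ ≤ ‖w‖ := by linarith [Metric.mem_ball.1 hw]
    have h3 : (R - 2 * ρ) ^ 2 ≤ ‖w‖ ^ 2 := pow_le_pow_left₀ (by linarith) h2 2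
    nlinarith
  calc _ = ENNReal.ofReal (Real.pi ^ ((n : ℝ) / 2) * Real.exp (R ^ 2 - 2)) *
        volume (Metric.ball z ρ) := by
        rw [ENNReal.ofReal_mul (by positivity), ENNReal.ofReal_mul (p := ρ ^ n) (by positivity),
          ENNReal.ofReal_toReal measure_ball_lt_top.ne,
          Measure.addHaar_ball_of_pos _ _ hρ0, finrank_euclideanSpace_fin]
    _ ≤ gammaM1 n (Metric.ball z ρ) := ofReal_mul_volume_ball_le_gammaM1_ball hnorm
    _ ≤ gammaM1 n (Metric.ball x r) :=
        measure_mono (Metric.ball_subset_ball' (by rw [hdist]; linarith))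

theorem exists_inv_gammaM1_ball_le {n : ℕ} (hn : 1 ≤ n) :
    ∃ K : ℝ, 0 < K ∧ ∀ x y : EuclideanSpace ℝ (Fin n), (x, y) ∉ localN n →
      (gammaM1 n (Metric.ball x ‖x - y‖))⁻¹ ≤
        ENNReal.ofReal ((Real.pi ^ ((n : ℝ) / 2) * Real.exp (‖x‖ ^ 2))⁻¹ *
          (K * (decayProfile n 1 ‖x - y‖ + decayProfile n (‖y‖ + 2) ‖x - y‖))) := by
  set v := (volume (Metric.ball (0 : EuclideanSpace ℝ (Fin n)) 1)).toReal with hv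
  have hv0 : 0 < v :=
    ENNReal.toReal_pos (Metric.measure_ball_pos _ _ one_pos).ne' measure_ball_lt_top.ne
  set L : ℝ := (2 * n + 1).factorial * 2 ^ (n + 1) + Real.exp 3 * (n + 1).factorial with hL
  refine ⟨Real.exp 2 * 2 ^ n * v⁻¹ * L, by positivity, fun x y hxy => ?_⟩
  set r := ‖x - y‖ with hr
  have hxy' : 1 < r ∨ 1 < r * ‖x‖ := by
    by_contra! h
    exact hxy h
  have hx := norm_nonneg x
  have hr0 : 0 < r := by
    rcases hxy' with h | h
    · linarith
    · exact pos_of_mul_pos_left (by linarith) hx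
  have hR : 1 ≤ r * (‖x‖ + r) := by rcases hxy' with h | h <;> nlinarith
  have hxyr : ‖x‖ ≤ ‖y‖ + r := by linarith [norm_sub_norm_le x y]
  have hyxr : ‖y‖ ≤ ‖x‖ + r := by
    have := norm_sub_norm_le y x
    rw [norm_sub_rev] at this
    linarith
  refine (ENNReal.inv_le_inv.2 (le_gammaM1_ball hn x hr0 hR)).trans ?_
  rw [← ENNReal.ofReal_inv_of_pos (by positivity)]
  refine ENNReal.ofReal_le_ofReal ?_
  have key := pow_mul_exp_sq_sub_sq_le n hx (norm_nonneg y) hr0.le hxyr hyxr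
  calc _ = (Real.pi ^ ((n : ℝ) / 2) * Real.exp (‖x‖ ^ 2))⁻¹ * (Real.exp 2 * 2 ^ n * v⁻¹ *
        ((‖x‖ + r) ^ n * Real.exp (‖x‖ ^ 2 - (‖x‖ + r) ^ 2))) := by
        rw [← hv, Real.exp_sub, Real.exp_sub, inv_pow, mul_pow]
        field_simp
    _ ≤ _ := by
        rw [mul_assoc _ L]
        gcongr

theorem lintegral_gammaM1_inv_density_mul {n : ℕ} {K : ℝ} (hK : 0 ≤ K)
    (y : EuclideanSpace ℝ (Fin n)) :
    ∫⁻ x, ENNReal.ofReal ((Real.pi ^ ((n : ℝ) / 2) * Real.exp (‖x‖ ^ 2))⁻¹ *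
        (K * (decayProfile n 1 ‖x - y‖ + decayProfile n (‖y‖ + 2) ‖x - y‖))) ∂gammaM1 n =
      ENNReal.ofReal K *
        (2 * ∫⁻ x : EuclideanSpace ℝ (Fin n), ENNReal.ofReal (((1 + ‖x‖) ^ (n + 1))⁻¹)) := by
  have hy : 0 < ‖y‖ + 2 := by positivity
  have hmeas : ∀ M : ℝ, Measurable fun x : EuclideanSpace ℝ (Fin n) =>
      ENNReal.ofReal (decayProfile n M ‖x - y‖) := fun M => by
    unfold decayProfile; fun_prop
  rw [gammaM1, lintegral_withDensity_eq_lintegral_mul _ (by fun_prop)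
    (by unfold decayProfile; fun_prop)]
  have hpt : ∀ x : EuclideanSpace ℝ (Fin n),
      ENNReal.ofReal (Real.pi ^ ((n : ℝ) / 2) * Real.exp (‖x‖ ^ 2)) *
        ENNReal.ofReal ((Real.pi ^ ((n : ℝ) / 2) * Real.exp (‖x‖ ^ 2))⁻¹ *
        (K * (decayProfile n 1 ‖x - y‖ + decayProfile n (‖y‖ + 2) ‖x - y‖))) =
      ENNReal.ofReal K * (ENNReal.ofReal (decayProfile n 1 ‖x - y‖) +
        ENNReal.ofReal (decayProfile n (‖y‖ + 2) ‖x - y‖)) := fun x => by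
    rw [← ENNReal.ofReal_mul (by positivity), mul_inv_cancel_left₀ (by positivity),
      ENNReal.ofReal_mul hK, ENNReal.ofReal_add
        (decayProfile_nonneg n zero_le_one (norm_nonneg _))
        (decayProfile_nonneg n hy.le (norm_nonneg _))]
  simp only [Pi.mul_apply, hpt]
  rw [lintegral_const_mul _ (by fun_prop), lintegral_add_left (hmeas _),
    lintegral_decayProfile n one_pos, lintegral_decayProfile n hy, two_mul]

/-- The global part of the centered Hardy–Littlewood maximal operator
with respect to `γ₋₁` is bounded on `L¹(ℝⁿ, γ₋₁)`. -/
theorem stmt4 (n : ℕ) (hn : 1 ≤ n) :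
    ∃ C : ℝ, 0 < C ∧ ∀ g : EuclideanSpace ℝ (Fin n) → ℝ≥0∞, Measurable g →
      (∫⁻ x, (⨆ (r : ℝ) (_ : 0 < r), (gammaM1 n (Metric.ball x r))⁻¹ *
          ∫⁻ y in Metric.ball x r,
            Set.indicator ((localN n)ᶜ) (fun _ => (1 : ℝ≥0∞)) (x, y) * g y ∂gammaM1 n)
        ∂gammaM1 n)
        ≤ ENNReal.ofReal C * ∫⁻ y, g y ∂gammaM1 n := by
  obtain ⟨K, hK, hker⟩ := exists_inv_gammaM1_ball_le hn
  set I := ∫⁻ x : EuclideanSpace ℝ (Fin n), ENNReal.ofReal (((1 + ‖x‖) ^ (n + 1))⁻¹) with hI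
  have hItop : I ≠ ∞ := (lintegral_inv_one_add_norm_pow_lt_top n).ne
  refine ⟨K * (2 * I.toReal + 1), by positivity, fun g hg => ?_⟩
  let H : EuclideanSpace ℝ (Fin n) → EuclideanSpace ℝ (Fin n) → ℝ≥0∞ := fun x y =>
    ENNReal.ofReal ((Real.pi ^ ((n : ℝ) / 2) * Real.exp (‖x‖ ^ 2))⁻¹ *
      (K * (decayProfile n 1 ‖x - y‖ + decayProfile n (‖y‖ + 2) ‖x - y‖)))
  have hH : Measurable (Function.uncurry H) := by
    simp only [H, decayProfile, Function.uncurry_def]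
    fun_prop
  have : SFinite (gammaM1 n) := by unfold gammaM1; infer_instance
  calc _ ≤ ∫⁻ x, ∫⁻ y, H x y * g y ∂gammaM1 n ∂gammaM1 n := by
        refine lintegral_mono fun x => iSup₂_le fun r _ => ?_
        refine (lintegral_const_mul_le _ _).trans <|
          (setLIntegral_mono' Metric.isOpen_ball.measurableSet fun y hy => ?_).trans
            (setLIntegral_le_lintegral _ _)
        by_cases hxy : (x, y) ∈ localN n
        · simp [hxy]
        · rw [Set.indicator_of_mem (by exact hxy), one_mul]
          have hsub : Metric.ball x ‖x - y‖ ⊆ Metric.ball x r :=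
            Metric.ball_subset_ball (by
              rw [← dist_eq_norm, dist_comm]; exact (Metric.mem_ball.1 hy).le)
          gcongr
          exact (ENNReal.inv_le_inv.2 (measure_mono hsub)).trans (hker x y hxy)
    _ = ∫⁻ y, ∫⁻ x, H x y * g y ∂gammaM1 n ∂gammaM1 n :=
        lintegral_lintegral_swap (hH.mul (hg.comp measurable_snd)).aemeasurable
    _ = ∫⁻ y, ENNReal.ofReal K * (2 * I) * g y ∂gammaM1 n := by
        refine lintegral_congr fun y => ?_
        rw [lintegral_mul_const _ hH.of_uncurry_right,
          lintegral_gammaM1_inv_density_mul hK.le]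
    _ = ENNReal.ofReal K * (2 * I) * ∫⁻ y, g y ∂gammaM1 n := lintegral_const_mul _ hg
    _ ≤ _ := by
        gcongr
        rw [ENNReal.ofReal_mul hK.le]
        gcongr
        rw [← ENNReal.ofReal_toReal (ENNReal.mul_ne_top ENNReal.ofNat_ne_top hItop)]
        refine ENNReal.ofReal_le_ofReal ?_
        rw [ENNReal.toReal_mul, ENNReal.toReal_ofNat]
        linarith
end

section
/- Let n ≥ 1. The operator g ↦ ∫_{ℝⁿ} sup_{t>0} T_t^𝒜(x,y) χ_{N^c}(x,y) g(y) dy is of weak type (1,1) with respect to γ₋₁: there exists C > 0 such that for every measurable g : ℝⁿ → [0,∞] with ∫ g γ₋₁ dy < ∞ and every λ > 0, γ₋₁({x ∈ ℝⁿ : ∫_{ℝⁿ} sup_{t>0} T_t^𝒜(x,y) χ_{N^c}(x,y) g(y) dy > λ}) ≤ C λ^{−1} ∫_{ℝⁿ} g(y) γ₋₁(y) dy. -/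
open MeasureTheory Real
open scoped ENNReal

/-- The kernel `T_t^𝒜(x,y)` of the semigroup generated by `-𝒜`, where
`𝒜 = -½Δ - x·∇` on `ℝⁿ`. -/
noncomputable def heatKerA (n : ℕ) (t : ℝ) (x y : EuclideanSpace ℝ (Fin n)) : ℝ :=
  Real.exp (-(n : ℝ) * t) * Real.pi ^ (-(n : ℝ) / 2) *
    (1 - Real.exp (-2 * t)) ^ (-(n : ℝ) / 2) *
    Real.exp (-‖x - Real.exp (-t) • y‖ ^ 2 / (1 - Real.exp (-2 * t)))

/-- A Gaussian absorbs every power of `1 + z`. -/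
lemma exists_one_add_pow_mul_exp_neg_sq_le (N : ℕ) :
    ∃ C : ℝ, 0 < C ∧ ∀ z : ℝ, 0 ≤ z → (1 + z) ^ N * exp (-z ^ 2) ≤ C := by
  refine ⟨N.factorial * exp 2, by positivity, fun z hz => ?_⟩
  have h1 : (1 + z) ^ N ≤ N.factorial * exp (1 + z) := by
    have := Real.pow_div_factorial_le_exp (1 + z) (by linarith) N
    rwa [div_le_iff₀ (by positivity), mul_comm] at this
  calc (1 + z) ^ N * exp (-z ^ 2) ≤ N.factorial * exp (1 + z) * exp (-z ^ 2) := by gcongr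
    _ = N.factorial * exp (1 + z + -z ^ 2) := by rw [mul_assoc, ← exp_add]
    _ ≤ N.factorial * exp 2 := by
      gcongr
      nlinarith [sq_nonneg (z - 1)]

lemma exists_pow_mul_exp_neg_sq_div_le (m : ℕ) :
    ∃ C : ℝ, 0 < C ∧ ∀ u d q R : ℝ, 0 < u → 0 ≤ d → 0 < q → q ≤ 1 → 0 ≤ R → |u - R| ≤ d →
      1 ≤ 4 * (1 + u) * (q + d) →
      u ^ (m + 1) / (1 + u ^ 2) * (exp (-d ^ 2 / q ^ 2) / q ^ (m + 1)) ≤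
        C * ((1 + R) ^ (2 * m) / (1 + (1 + R) * d) ^ (m + 1)) := by
  obtain ⟨C, hC, h⟩ := exists_one_add_pow_mul_exp_neg_sq_le (2 * m + 2 * (m + 1))
  refine ⟨2 * 5 ^ (m + 1) * C, by positivity, fun u d q R hu hd hq hq1 hR huR hlow => ?_⟩
  obtain ⟨z, rfl⟩ : ∃ z, d = q * z := ⟨d / q, by field_simp⟩
  have hz : 0 ≤ z := nonneg_of_mul_nonneg_right hd hq
  have hdz : q * z ≤ z := by nlinarith
  obtain ⟨h1, h2⟩ := abs_le.1 huR
  have hE : exp (-(q * z) ^ 2 / q ^ 2) = exp (-z ^ 2) := by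
    congr 1
    field_simp
  rw [hE, div_mul_div_comm, ← mul_div_assoc, div_le_div_iff₀ (by positivity) (by positivity)]
  have hA : 1 + R ≤ (1 + u) * (1 + q * z) := by nlinarith [mul_nonneg hu.le hd]
  have hv : 1 + u ≤ (1 + R) * (1 + z) := by nlinarith [mul_nonneg hR hz]
  have hw : 1 + (1 + u) * (q * z) ≤ 5 * ((1 + u) * q * (1 + z)) := by
    have : 0 < (1 + u) * q := by positivity
    nlinarith
  have hAd : 1 + (1 + R) * (q * z) ≤ 5 * ((1 + u) * q) * (1 + z) ^ 2 := by
    calc 1 + (1 + R) * (q * z) ≤ 1 + ((1 + u) * (1 + q * z)) * (q * z) := by gcongr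
      _ ≤ (1 + (1 + u) * (q * z)) * (1 + q * z) := by nlinarith
      _ ≤ 5 * ((1 + u) * q * (1 + z)) * (1 + z) := by gcongr
      _ = _ := by ring
  calc u ^ (m + 1) * exp (-z ^ 2) * (1 + (1 + R) * (q * z)) ^ (m + 1)
      ≤ (1 + u) ^ (m + 1) * exp (-z ^ 2) * (5 * ((1 + u) * q) * (1 + z) ^ 2) ^ (m + 1) := by
        gcongr
        linarith
    _ = 5 ^ (m + 1) * exp (-z ^ 2) * (1 + z) ^ (2 * (m + 1)) * q ^ (m + 1) *
          ((1 + u) ^ (2 * m) * (1 + u) ^ 2) := by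
        simp only [mul_pow, ← pow_mul]
        ring
    _ ≤ 5 ^ (m + 1) * exp (-z ^ 2) * (1 + z) ^ (2 * (m + 1)) * q ^ (m + 1) *
          (((1 + R) * (1 + z)) ^ (2 * m) * (2 * (1 + u ^ 2))) := by
        gcongr
        nlinarith [sq_nonneg (u - 1)]
    _ = 2 * 5 ^ (m + 1) * ((1 + z) ^ (2 * m + 2 * (m + 1)) * exp (-z ^ 2)) *
          (1 + R) ^ (2 * m) * ((1 + u ^ 2) * q ^ (m + 1)) := by
        rw [mul_pow (1 + R)]
        ring
    _ ≤ 2 * 5 ^ (m + 1) * C * (1 + R) ^ (2 * m) * ((1 + u ^ 2) * q ^ (m + 1)) := by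
        gcongr
        exact h z hz

/-- If `(ρσ, y)` is global, then `rρσ` and `y` cannot be close unless `r` is far from `1`. -/
lemma one_le_of_notMem_localN {n : ℕ} {ρ r q : ℝ} {σ y : EuclideanSpace ℝ (Fin n)}
    (hρ : 0 < ρ) (hr : 0 < r) (hr1 : r < 1) (hq : 0 < q) (hqr : q ^ 2 = 1 - r ^ 2)
    (hσ : ‖σ‖ = 1) (hN : (ρ • σ, y) ∉ localN n) :
    1 ≤ 4 * (1 + r * ρ) * (q + ‖(r * ρ) • σ - y‖) := by
  have hx : ‖ρ • σ‖ = ρ := by rw [norm_smul, hσ, mul_one, Real.norm_of_nonneg hρ.le]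
  have hD : 1 < ‖ρ • σ - y‖ * (1 + ρ) := by
    simp only [localN, Set.mem_ofPred_eq, hx, not_and_or, not_le] at hN
    rcases hN with h | h <;> nlinarith [norm_nonneg (ρ • σ - y)]
  have hd : ‖ρ • σ - y‖ ≤ (1 - r) * ρ + ‖(r * ρ) • σ - y‖ := by
    have h1 : ρ • σ - y = ((1 - r) * ρ) • σ + ((r * ρ) • σ - y) := by module
    rw [h1]
    refine (norm_add_le _ _).trans_eq ?_
    rw [norm_smul, hσ, mul_one, Real.norm_of_nonneg (by nlinarith)]
  generalize ‖ρ • σ - y‖ = D at *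
  have hd0 := norm_nonneg ((r * ρ) • σ - y)
  generalize ‖(r * ρ) • σ - y‖ = d at *
  have hu : 0 < r * ρ := by positivity
  by_cases hq2 : 1 / 2 ≤ q
  · nlinarith [mul_nonneg hu.le hd0, mul_nonneg hu.le hq.le]
  · have hr2 : 1 / 2 ≤ r := by nlinarith
    have h3 : ρ ≤ 2 * (r * ρ) := by nlinarith
    have h4 : (1 - r) * ρ ≤ 2 * (r * ρ) * q ^ 2 := by
      rw [hqr]
      nlinarith [mul_nonneg (mul_nonneg (sub_nonneg.2 hr1.le) hρ.le) (sub_nonneg.2 hr2),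
        mul_pos hr hρ, mul_pos hr hu]
    generalize r * ρ = u at *
    have h5 : D * (1 + ρ) ≤ (2 * u * q ^ 2 + d) * (1 + 2 * u) := by
      gcongr
      linarith
    by_contra! h
    have hw : 0 ≤ (1 + u) * q := by positivity
    have hw' : 0 ≤ (1 + u) * d := by positivity
    nlinarith [mul_nonneg hu.le hd0, sq_nonneg q, mul_nonneg hu.le (sq_nonneg q), mul_nonneg hw hw']

/-- The angular majorant of the kernel. -/
noncomputable def angularKer (n : ℕ) (σ y : EuclideanSpace ℝ (Fin n)) : ℝ :=
  (1 + ‖y‖) ^ (2 * (n - 1)) / (1 + (1 + ‖y‖) ^ 2 * ‖σ - ‖y‖⁻¹ • y‖) ^ n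

lemma one_add_sq_mul_norm_sub_le {E : Type*} [NormedAddCommGroup E] [NormedSpace ℝ E]
    {u : ℝ} {σ y : E} (hu : 0 ≤ u) (hσ : ‖σ‖ = 1) :
    1 + (1 + ‖y‖) ^ 2 * ‖σ - ‖y‖⁻¹ • y‖ ≤ 9 * (1 + (1 + ‖y‖) * ‖u • σ - y‖) := by
  have h1 : |u - ‖y‖| ≤ ‖u • σ - y‖ := by
    have := abs_norm_sub_norm_le (u • σ) y
    rwa [norm_smul, hσ, mul_one, Real.norm_of_nonneg hu] at this
  have h2 : ‖y‖ * ‖σ - ‖y‖⁻¹ • y‖ ≤ 2 * ‖u • σ - y‖ := by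
    have h3 : ‖y‖ • (σ - ‖y‖⁻¹ • y) = (‖y‖ - u) • σ + (u • σ - y) := by
      rcases eq_or_ne y 0 with rfl | hy
      · simp
      · rw [smul_sub, smul_smul, mul_inv_cancel₀ (norm_ne_zero_iff.2 hy)]
        module
    have h4 : ‖‖y‖ • (σ - ‖y‖⁻¹ • y)‖ = ‖y‖ * ‖σ - ‖y‖⁻¹ • y‖ := by
      rw [norm_smul, norm_norm]
    rw [← h4, h3]
    refine (norm_add_le _ _).trans ?_
    rw [norm_smul, hσ, mul_one, Real.norm_eq_abs, abs_sub_comm]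
    linarith
  have h5 : ‖σ - ‖y‖⁻¹ • y‖ ≤ 2 := by
    refine (norm_sub_le _ _).trans ?_
    rw [hσ, norm_smul, norm_inv, norm_norm]
    linarith [inv_mul_le_one (a := ‖y‖)]
  have h6 := norm_nonneg y
  have h7 := norm_nonneg (σ - ‖y‖⁻¹ • y)
  have h8 := norm_nonneg (u • σ - y)
  generalize ‖y‖ = R at *
  generalize ‖σ - R⁻¹ • y‖ = τ at *
  generalize ‖u • σ - y‖ = d at *
  nlinarith [mul_nonneg h6 h8, mul_nonneg h6 h7, mul_le_mul_of_nonneg_left h2 h6,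
    mul_nonneg h7 (sq_nonneg (R - 1))]

lemma exists_mul_heatKerA_le (n : ℕ) (hn : 1 ≤ n) :
    ∃ C : ℝ, 0 < C ∧ ∀ (ρ t : ℝ) (σ y : EuclideanSpace ℝ (Fin n)), 0 < ρ → 0 < t → ‖σ‖ = 1 →
      (ρ • σ, y) ∉ localN n →
      2 * ρ ^ n * exp (ρ ^ 2) / (1 + ρ ^ 2) * heatKerA n t (ρ • σ) y ≤
        C * angularKer n σ y * exp (‖y‖ ^ 2) := by
  obtain ⟨m, rfl⟩ : ∃ m, n = m + 1 := ⟨n - 1, by omega⟩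
  obtain ⟨C, hC, h⟩ := exists_pow_mul_exp_neg_sq_div_le m
  refine ⟨2 * C * 9 ^ (m + 1), by positivity, fun ρ t σ y hρ ht hσ hN => ?_⟩
  obtain ⟨r, hrt⟩ : ∃ r, r = exp (-t) := ⟨_, rfl⟩
  have hr : 0 < r := hrt ▸ exp_pos _
  have hr1 : r < 1 := by rw [hrt]; exact Real.exp_lt_one_iff.2 (by linarith)
  have hr2 : exp (-2 * t) = r ^ 2 := by
    rw [hrt, ← exp_nat_mul]
    congr 1
    push_cast
    ring
  have hrn : exp (-((m + 1 : ℕ) : ℝ) * t) = r ^ (m + 1) := by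
    rw [hrt, ← exp_nat_mul]
    congr 1
    ring
  have hs : 0 < 1 - r ^ 2 := by nlinarith
  obtain ⟨q, hq, hqr⟩ : ∃ q : ℝ, 0 < q ∧ q ^ 2 = 1 - r ^ 2 :=
    ⟨√(1 - r ^ 2), Real.sqrt_pos.2 hs, Real.sq_sqrt hs.le⟩
  have hqn : (1 - r ^ 2) ^ (-((m + 1 : ℕ) : ℝ) / 2) = (q ^ (m + 1))⁻¹ := by
    rw [← hqr, ← Real.rpow_natCast q 2, ← Real.rpow_mul hq.le, ← Real.rpow_natCast q (m + 1),
      ← Real.rpow_neg hq.le]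
    congr 1
    push_cast
    ring
  have hπ : π ^ (-((m + 1 : ℕ) : ℝ) / 2) ≤ 1 := by
    refine Real.rpow_le_one_of_one_le_of_nonpos (by linarith [Real.pi_gt_three]) ?_
    have : (0 : ℝ) ≤ ((m + 1 : ℕ) : ℝ) := by positivity
    linarith
  have hexp : -‖ρ • σ - r • y‖ ^ 2 / q ^ 2 =
      ‖y‖ ^ 2 - ρ ^ 2 + -‖(r * ρ) • σ - y‖ ^ 2 / q ^ 2 := by
    rw [norm_sub_sq_real, norm_sub_sq_real]
    simp only [norm_smul, inner_smul_left, inner_smul_right, hσ, mul_one, Real.norm_eq_abs, sq_abs,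
      mul_pow, conj_trivial]
    field_simp
    rw [hqr]
    ring
  have hlow := one_le_of_notMem_localN hρ hr hr1 hq hqr hσ hN
  have hu : 0 < r * ρ := by positivity
  have habs : |r * ρ - ‖y‖| ≤ ‖(r * ρ) • σ - y‖ := by
    have := abs_norm_sub_norm_le ((r * ρ) • σ) y
    rwa [norm_smul, hσ, mul_one, Real.norm_of_nonneg hu.le] at this
  have key := h (r * ρ) _ q ‖y‖ hu (norm_nonneg _) hq (by nlinarith) (norm_nonneg _) habs hlow
  have hang : (1 + ‖y‖) ^ (2 * m) / (1 + (1 + ‖y‖) * ‖(r * ρ) • σ - y‖) ^ (m + 1) ≤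
      9 ^ (m + 1) * angularKer (m + 1) σ y := by
    rw [angularKer, Nat.add_sub_cancel, ← mul_div_assoc, div_le_div_iff₀ (by positivity)
      (by positivity), mul_comm (9 ^ (m + 1)), mul_assoc, ← mul_pow]
    gcongr
    exact one_add_sq_mul_norm_sub_le hu.le hσ
  rw [heatKerA, hrn, hr2, hqn, ← hrt, ← hqr, hexp, exp_add, exp_sub]
  calc 2 * ρ ^ (m + 1) * exp (ρ ^ 2) / (1 + ρ ^ 2) *
        (r ^ (m + 1) * π ^ (-((m + 1 : ℕ) : ℝ) / 2) * (q ^ (m + 1))⁻¹ *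
          (exp (‖y‖ ^ 2) / exp (ρ ^ 2) * exp (-‖(r * ρ) • σ - y‖ ^ 2 / q ^ 2)))
      = 2 * exp (‖y‖ ^ 2) * π ^ (-((m + 1 : ℕ) : ℝ) / 2) * ((r * ρ) ^ (m + 1) / (1 + ρ ^ 2) *
          (exp (-‖(r * ρ) • σ - y‖ ^ 2 / q ^ 2) / q ^ (m + 1))) := by
        rw [mul_pow]
        have := exp_pos (ρ ^ 2)
        field_simp
    _ ≤ 2 * exp (‖y‖ ^ 2) * 1 * ((r * ρ) ^ (m + 1) / (1 + (r * ρ) ^ 2) *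
          (exp (-‖(r * ρ) • σ - y‖ ^ 2 / q ^ 2) / q ^ (m + 1))) := by
        gcongr
        nlinarith
    _ ≤ 2 * exp (‖y‖ ^ 2) * 1 * (C * (9 ^ (m + 1) * angularKer (m + 1) σ y)) := by
        refine mul_le_mul_of_nonneg_left ?_ (by positivity)
        exact key.trans (mul_le_mul_of_nonneg_left hang hC.le)
    _ = _ := by ring

/-- Integration in polar coordinates. -/
lemma lintegral_eq_lintegral_toSphere {E : Type*} [NormedAddCommGroup E] [NormedSpace ℝ E]
    [FiniteDimensional ℝ E] [Nontrivial E] [MeasurableSpace E] [BorelSpace E] (μ : Measure E)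
    [μ.IsAddHaarMeasure] {f : E → ℝ≥0∞} (hf : Measurable f) :
    ∫⁻ x, f x ∂μ = ∫⁻ σ, (∫⁻ r in Set.Ioi (0 : ℝ),
      ENNReal.ofReal (r ^ (Module.finrank ℝ E - 1)) * f (r • (σ : E))) ∂μ.toSphere := by
  have hmeas : Measurable fun p : Metric.sphere (0 : E) 1 × Set.Ioi (0 : ℝ) =>
      f ((p.2 : ℝ) • (p.1 : E)) := by fun_prop
  have h0 : MeasurableSet ({0}ᶜ : Set E) := (measurableSet_singleton _).compl
  calc ∫⁻ x, f x ∂μ = ∫⁻ x : ({0}ᶜ : Set E), f x ∂(μ.comap (↑)) := by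
        rw [lintegral_subtype_comap h0 f, restrict_compl_singleton]
    _ = ∫⁻ p, f ((p.2 : ℝ) • (p.1 : E))
          ∂(μ.toSphere.prod (Measure.volumeIoiPow (Module.finrank ℝ E - 1))) := by
        rw [← μ.measurePreserving_homeomorphUnitSphereProd.lintegral_comp hmeas]
        refine lintegral_congr fun x => ?_
        have hx : ‖(x : E)‖ ≠ 0 := norm_ne_zero_iff.2 x.2
        simp [smul_smul, mul_inv_cancel₀ hx]
    _ = _ := by
        rw [lintegral_prod _ hmeas.aemeasurable]
        refine lintegral_congr fun σ => ?_
        have h1 : Measurable fun r : Set.Ioi (0 : ℝ) => f ((r : ℝ) • (σ : E)) := by fun_prop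
        rw [Measure.volumeIoiPow, lintegral_withDensity_eq_lintegral_mul _ (by fun_prop) h1,
          ← lintegral_subtype_comap measurableSet_Ioi]
        rfl

/-- If `ν (Iic a) ≤ B` for all `a ∈ s`, then `ν s ≤ B`. -/
lemma measure_le_of_forall_measure_Iic_le (ν : Measure ℝ) (s : Set ℝ) (B : ℝ≥0∞)
    (h : ∀ a ∈ s, ν (Set.Iic a) ≤ B) : ν s ≤ B := by
  by_cases hmax : ∃ a ∈ s, ∀ b ∈ s, b ≤ a
  · obtain ⟨a, ha, hb⟩ := hmax
    exact (measure_mono hb).trans (h a ha)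
  push Not at hmax
  let Q := {q : ℚ // ∃ b ∈ s, (q : ℝ) ≤ b}
  have hsub : s ⊆ ⋃ q : Q, Set.Iic ((q : ℚ) : ℝ) := fun a ha => by
    obtain ⟨b, hb, hab⟩ := hmax a ha
    obtain ⟨q, hq1, hq2⟩ := exists_rat_btwn hab
    exact Set.mem_iUnion.2 ⟨⟨q, b, hb, hq2.le⟩, hq1.le⟩
  have hdir : Directed (· ⊆ ·) fun q : Q => Set.Iic ((q : ℚ) : ℝ) :=
    directed_of_isDirected_le fun p q hpq => Set.Iic_subset_Iic.2 (Rat.cast_le.2 hpq)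
  refine (measure_mono hsub).trans ?_
  rw [hdir.measure_iUnion]
  refine iSup_le fun ⟨q, b, hb, hqb⟩ => ?_
  exact (measure_mono (Set.Iic_subset_Iic.2 hqb)).trans (h b hb)

/-- The radial part of the inverse Gaussian measure. -/
noncomputable def radialMeasure (n : ℕ) : Measure ℝ :=
  (volume.restrict (Set.Ioi 0)).withDensity fun r => ENNReal.ofReal (r ^ (n - 1) * exp (r ^ 2))

lemma radialMeasure_Iic_le {n : ℕ} (hn : 1 ≤ n) {ρ : ℝ} (hρ : 0 < ρ) :
    radialMeasure n (Set.Iic ρ) ≤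
      ENNReal.ofReal (2 * ρ ^ n * exp (ρ ^ 2) / (1 + ρ ^ 2)) := by
  obtain ⟨m, rfl⟩ : ∃ m, n = m + 1 := ⟨n - 1, by omega⟩
  have hint : ∫ u in (0 : ℝ)..ρ, ρ ^ m * exp (ρ * u) = ρ ^ m * ((exp (ρ ^ 2) - 1) / ρ) := by
    rw [intervalIntegral.integral_const_mul, intervalIntegral.integral_comp_mul_left _ hρ.ne']
    simp [integral_exp, div_eq_inv_mul, sq]
  rw [radialMeasure, withDensity_apply _ measurableSet_Iic, Measure.restrict_restrict
    measurableSet_Iic, Set.inter_comm, Set.Ioi_inter_Iic, Nat.add_sub_cancel]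
  calc ∫⁻ u in Set.Ioc 0 ρ, ENNReal.ofReal (u ^ m * exp (u ^ 2))
      ≤ ∫⁻ u in Set.Ioc 0 ρ, ENNReal.ofReal (ρ ^ m * exp (ρ * u)) := by
        refine setLIntegral_mono (by fun_prop) fun u hu => ENNReal.ofReal_le_ofReal ?_
        have := hu.1.le
        have := hu.2
        gcongr
        nlinarith
    _ = ENNReal.ofReal (ρ ^ m * ((exp (ρ ^ 2) - 1) / ρ)) := by
        rw [← hint, intervalIntegral.integral_of_le hρ.le, ofReal_integral_eq_lintegral_ofReal]
        · exact (Continuous.integrableOn_Ioc (by fun_prop))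
        · exact Filter.Eventually.of_forall fun u => by positivity
    _ ≤ _ := by
        refine ENNReal.ofReal_le_ofReal ?_
        have h1 : exp (ρ ^ 2) * (1 - ρ ^ 2) ≤ 1 := by
          have h2 := Real.one_sub_le_exp_neg (ρ ^ 2)
          have h3 : exp (ρ ^ 2) * exp (-ρ ^ 2) = 1 := by rw [← exp_add]; simp
          calc _ ≤ exp (ρ ^ 2) * exp (-ρ ^ 2) := by gcongr
            _ = 1 := h3
        rw [← mul_div_assoc, div_le_div_iff₀ hρ (by positivity)]
        calc ρ ^ m * (exp (ρ ^ 2) - 1) * (1 + ρ ^ 2) ≤ ρ ^ m * (2 * ρ ^ 2 * exp (ρ ^ 2)) := by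
              rw [mul_assoc]
              refine mul_le_mul_of_nonneg_left ?_ (by positivity)
              nlinarith [sq_nonneg ρ]
          _ = _ := by ring

lemma lintegral_comp_smul_sub {E : Type*} [NormedAddCommGroup E] [NormedSpace ℝ E]
    [FiniteDimensional ℝ E] [MeasurableSpace E] [BorelSpace E] (μ : Measure E)
    [μ.IsAddHaarMeasure] {f : E → ℝ≥0∞} (hf : Measurable f) {b : ℝ} (hb : 0 < b) (e : E) :
    ∫⁻ x, f (b • (x - e)) ∂μ =
      ENNReal.ofReal ((b ^ Module.finrank ℝ E)⁻¹) * ∫⁻ x, f x ∂μ := by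
  rw [lintegral_sub_right_eq_self (fun x => f (b • x)) e,
    ← lintegral_map hf (measurable_const_smul b), Measure.map_addHaar_smul μ hb.ne',
    lintegral_smul_measure, abs_of_pos (by positivity), smul_eq_mul]

lemma exists_lintegral_toSphere_le (E : Type*) [NormedAddCommGroup E] [NormedSpace ℝ E]
    [FiniteDimensional ℝ E] [Nontrivial E] [MeasurableSpace E] [BorelSpace E] (μ : Measure E)
    [μ.IsAddHaarMeasure] :
    ∃ C : ℝ, 0 < C ∧ ∀ (b : ℝ) (e : E), 0 < b →
      ∫⁻ σ, ENNReal.ofReal (b ^ (Module.finrank ℝ E - 1) /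
        (1 + b * ‖(σ : E) - e‖) ^ Module.finrank ℝ E) ∂μ.toSphere ≤ ENNReal.ofReal C := by
  obtain ⟨m, hm⟩ : ∃ m, Module.finrank ℝ E = m + 1 :=
    ⟨Module.finrank ℝ E - 1, by have := Module.finrank_pos (R := ℝ) (M := E); omega⟩
  have hfin : ∫⁻ x : E, ENNReal.ofReal (((1 + ‖x‖) ^ (m + 2))⁻¹) ∂μ < ⊤ := by
    have := finite_integral_one_add_norm (μ := μ) (E := E) (r := ((m + 2 : ℕ) : ℝ))
      (by rw [hm]; push_cast; linarith)
    refine this.trans_eq' (lintegral_congr fun x => ?_)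
    rw [Real.rpow_neg (by positivity), Real.rpow_natCast]
  set I := ∫⁻ x : E, ENNReal.ofReal (((1 + ‖x‖) ^ (m + 2))⁻¹) ∂μ
  refine ⟨2 ^ (m + 2) * I.toReal + 1, by positivity, fun b e hb => ?_⟩
  rw [hm, Nat.add_sub_cancel]
  have hsc := lintegral_comp_smul_sub μ
    (f := fun x => ENNReal.ofReal (((1 + ‖x‖) ^ (m + 2))⁻¹)) (by fun_prop) hb e
  rw [lintegral_eq_lintegral_toSphere μ (by fun_prop), hm, Nat.add_sub_cancel] at hsc
  have hσ : ∀ σ : Metric.sphere (0 : E) 1,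
      ENNReal.ofReal (b ^ m / (1 + b * ‖(σ : E) - e‖) ^ (m + 1)) ≤
        ENNReal.ofReal (2 ^ (m + 2) * b ^ (m + 1)) * ∫⁻ r in Set.Ioi (0 : ℝ),
          ENNReal.ofReal (r ^ m) *
            ENNReal.ofReal (((1 + ‖b • (r • (σ : E) - e)‖) ^ (m + 2))⁻¹) := by
    intro σ
    have hσ1 : ‖(σ : E)‖ = 1 := by simp
    set τ := ‖(σ : E) - e‖
    have hτ0 : 0 ≤ τ := norm_nonneg _
    have hconst : ENNReal.ofReal (((2 * (1 + b * τ)) ^ (m + 2))⁻¹) *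
        ENNReal.ofReal ((1 + b * τ) / b) ≤ ∫⁻ r in Set.Ioi (0 : ℝ),
          ENNReal.ofReal (r ^ m) *
            ENNReal.ofReal (((1 + ‖b • (r • (σ : E) - e)‖) ^ (m + 2))⁻¹) := by
      calc _ = ∫⁻ r in Set.Ioc (1 : ℝ) (1 + (1 + b * τ) / b),
            ENNReal.ofReal (((2 * (1 + b * τ)) ^ (m + 2))⁻¹) := by
              rw [setLIntegral_const, Real.volume_Ioc, add_sub_cancel_left]
        _ ≤ ∫⁻ r in Set.Ioc (1 : ℝ) (1 + (1 + b * τ) / b), ENNReal.ofReal (r ^ m) *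
            ENNReal.ofReal (((1 + ‖b • (r • (σ : E) - e)‖) ^ (m + 2))⁻¹) := by
              refine setLIntegral_mono (by fun_prop) fun r hr => ?_
              have hr1 : 1 ≤ r := hr.1.le
              rw [← ENNReal.ofReal_mul (by positivity)]
              refine ENNReal.ofReal_le_ofReal ?_
              have h1 : ‖r • (σ : E) - e‖ ≤ (r - 1) + τ := by
                have h2 : r • (σ : E) - e = (r - 1) • (σ : E) + ((σ : E) - e) := by module
                rw [h2]
                refine (norm_add_le _ _).trans_eq ?_
                rw [norm_smul, hσ1, mul_one, Real.norm_of_nonneg (by linarith)]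
              have h3 : b * (r - 1) ≤ 1 + b * τ := by
                have := hr.2
                rw [← sub_le_iff_le_add', le_div_iff₀ hb] at this
                linarith
              have h4 : 1 + ‖b • (r • (σ : E) - e)‖ ≤ 2 * (1 + b * τ) := by
                rw [norm_smul, Real.norm_of_nonneg hb.le]
                nlinarith
              calc ((2 * (1 + b * τ)) ^ (m + 2))⁻¹
                  ≤ 1 * ((1 + ‖b • (r • (σ : E) - e)‖) ^ (m + 2))⁻¹ := by
                    rw [one_mul]
                    gcongr
                _ ≤ _ := by
                    gcongr
                    exact one_le_pow₀ hr1
        _ ≤ _ := lintegral_mono_set fun r hr => zero_lt_one.trans hr.1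
    refine le_trans (le_of_eq ?_) (mul_le_mul_right hconst _)
    rw [← ENNReal.ofReal_mul (by positivity), ← ENNReal.ofReal_mul (by positivity)]
    congr 1
    rw [mul_pow]
    field_simp
    ring
  calc _ ≤ ∫⁻ σ : Metric.sphere (0 : E) 1, ENNReal.ofReal (2 ^ (m + 2) * b ^ (m + 1)) *
        (∫⁻ r in Set.Ioi (0 : ℝ), ENNReal.ofReal (r ^ m) *
          ENNReal.ofReal (((1 + ‖b • (r • (σ : E) - e)‖) ^ (m + 2))⁻¹)) ∂μ.toSphere :=
        lintegral_mono hσ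
    _ = ENNReal.ofReal (2 ^ (m + 2)) * I := by
        rw [lintegral_const_mul' _ _ ENNReal.ofReal_ne_top, hsc, ← mul_assoc,
          ← ENNReal.ofReal_mul (by positivity)]
        congr 2
        field_simp
    _ ≤ _ := by
        rw [← ENNReal.ofReal_toReal hfin.ne, ← ENNReal.ofReal_mul (by positivity),
          ENNReal.toReal_ofReal ENNReal.toReal_nonneg]
        exact ENNReal.ofReal_le_ofReal (by linarith)

lemma measurable_iSup_heatKerA (n : ℕ) :
    Measurable fun p : EuclideanSpace ℝ (Fin n) × EuclideanSpace ℝ (Fin n) =>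
      ⨆ (t : ℝ) (_ : 0 < t), ENNReal.ofReal (heatKerA n t p.1 p.2) := by
  refine LowerSemicontinuous.measurable (lowerSemicontinuous_biSup fun t _ => ?_)
  refine Continuous.lowerSemicontinuous (ENNReal.continuous_ofReal.comp ?_)
  unfold heatKerA
  fun_prop

lemma isClosed_localN (n : ℕ) : IsClosed (localN n) := by
  have h1 : Continuous fun p : EuclideanSpace ℝ (Fin n) × EuclideanSpace ℝ (Fin n) =>
      ‖p.1 - p.2‖ := by fun_prop
  exact (isClosed_le h1 continuous_const).inter
    (isClosed_le (h1.mul continuous_fst.norm) continuous_const)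

lemma measurable_angularKer (n : ℕ) :
    Measurable fun p : EuclideanSpace ℝ (Fin n) × EuclideanSpace ℝ (Fin n) =>
      angularKer n p.1 p.2 := by
  unfold angularKer
  fun_prop

lemma angularKer_nonneg (n : ℕ) (σ y : EuclideanSpace ℝ (Fin n)) : 0 ≤ angularKer n σ y := by
  unfold angularKer
  positivity

lemma exists_lintegral_angularKer_le (n : ℕ) (hn : 1 ≤ n) :
    ∃ C : ℝ, 0 < C ∧ ∀ y : EuclideanSpace ℝ (Fin n),
      ∫⁻ σ : Metric.sphere (0 : EuclideanSpace ℝ (Fin n)) 1, ENNReal.ofReal (angularKer n σ y)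
        ∂(volume : Measure (EuclideanSpace ℝ (Fin n))).toSphere ≤ ENNReal.ofReal C := by
  have : Nonempty (Fin n) := ⟨⟨0, hn⟩⟩
  obtain ⟨C, hC, h⟩ := exists_lintegral_toSphere_le (EuclideanSpace ℝ (Fin n)) volume
  refine ⟨C, hC, fun y => ?_⟩
  have := h ((1 + ‖y‖) ^ 2) (‖y‖⁻¹ • y) (by positivity)
  rwa [finrank_euclideanSpace_fin, ← pow_mul] at this

/-- The inverse Gaussian measure in polar coordinates. -/
lemma gammaM1_eq_lintegral (n : ℕ) (hn : 1 ≤ n) {s : Set (EuclideanSpace ℝ (Fin n))}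
    (hs : MeasurableSet s) :
    gammaM1 n s = ∫⁻ σ, ENNReal.ofReal (π ^ ((n : ℝ) / 2)) *
      radialMeasure n {r | r • (σ : EuclideanSpace ℝ (Fin n)) ∈ s}
        ∂(volume : Measure (EuclideanSpace ℝ (Fin n))).toSphere := by
  have : Nonempty (Fin n) := ⟨⟨0, hn⟩⟩
  have hw : Measurable fun x : EuclideanSpace ℝ (Fin n) =>
      ENNReal.ofReal (π ^ ((n : ℝ) / 2) * exp (‖x‖ ^ 2)) := by fun_prop
  rw [gammaM1, withDensity_apply _ hs, ← lintegral_indicator hs,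
    lintegral_eq_lintegral_toSphere volume (hw.indicator hs), finrank_euclideanSpace_fin]
  refine lintegral_congr fun σ => ?_
  have hm : MeasurableSet {r : ℝ | r • (σ : EuclideanSpace ℝ (Fin n)) ∈ s} :=
    (show Measurable fun r : ℝ => r • (σ : EuclideanSpace ℝ (Fin n)) by fun_prop) hs
  rw [radialMeasure, withDensity_apply _ hm, ← lintegral_indicator hm,
    ← lintegral_const_mul' _ _ ENNReal.ofReal_ne_top]
  refine setLIntegral_congr_fun measurableSet_Ioi fun r (hr : 0 < r) => ?_
  by_cases hrs : r • (σ : EuclideanSpace ℝ (Fin n)) ∈ s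
  · have hσ : ‖r • (σ : EuclideanSpace ℝ (Fin n))‖ = r := by
      rw [norm_smul, norm_eq_of_mem_sphere, mul_one, Real.norm_of_nonneg hr.le]
    have hrs' : r ∈ {r : ℝ | r • (σ : EuclideanSpace ℝ (Fin n)) ∈ s} := hrs
    simp only [Set.indicator_of_mem hrs, Set.indicator_of_mem hrs', hσ]
    rw [← ENNReal.ofReal_mul (by positivity), ← ENNReal.ofReal_mul (by positivity)]
    congr 1
    ring
  · have hrs' : r ∉ {r : ℝ | r • (σ : EuclideanSpace ℝ (Fin n)) ∈ s} := hrs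
    simp [Set.indicator_of_notMem hrs, Set.indicator_of_notMem hrs']

lemma radialMeasure_Iic_of_nonpos (n : ℕ) {ρ : ℝ} (hρ : ρ ≤ 0) :
    radialMeasure n (Set.Iic ρ) = 0 := by
  rw [radialMeasure, withDensity_apply _ measurableSet_Iic, Measure.restrict_restrict
    measurableSet_Iic, Set.inter_comm, Set.Ioi_inter_Iic, Set.Ioc_eq_empty (by simpa using hρ)]
  simp

/-- The weight of the inverse Gaussian measure. -/
noncomputable def gammaM1Density (n : ℕ) (y : EuclideanSpace ℝ (Fin n)) : ℝ≥0∞ :=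
  ENNReal.ofReal (π ^ ((n : ℝ) / 2) * exp (‖y‖ ^ 2))

lemma measurable_gammaM1Density (n : ℕ) : Measurable (gammaM1Density n) := by
  unfold gammaM1Density
  fun_prop

lemma gammaM1_eq_withDensity (n : ℕ) : gammaM1 n = volume.withDensity (gammaM1Density n) := rfl

/-- A kernel dominated along rays by the angular majorant is of weak type `(1,1)`. -/
lemma gammaM1_lt_lintegral_le {n : ℕ} (hn : 1 ≤ n) {C₁ C₂ : ℝ} (hC₁ : 0 < C₁)
    (hang : ∀ y : EuclideanSpace ℝ (Fin n),
      ∫⁻ σ : Metric.sphere (0 : EuclideanSpace ℝ (Fin n)) 1, ENNReal.ofReal (angularKer n σ y)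
        ∂(volume : Measure (EuclideanSpace ℝ (Fin n))).toSphere ≤ ENNReal.ofReal C₂)
    {K : EuclideanSpace ℝ (Fin n) → EuclideanSpace ℝ (Fin n) → ℝ≥0∞}
    (hK : Measurable fun p : EuclideanSpace ℝ (Fin n) × EuclideanSpace ℝ (Fin n) => K p.1 p.2)
    (hpt : ∀ (σ : Metric.sphere (0 : EuclideanSpace ℝ (Fin n)) 1) (ρ : ℝ), 0 < ρ →
      ∀ y : EuclideanSpace ℝ (Fin n), ENNReal.ofReal (π ^ ((n : ℝ) / 2)) *
        radialMeasure n (Set.Iic ρ) * K (ρ • (σ : EuclideanSpace ℝ (Fin n))) y ≤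
          ENNReal.ofReal C₁ * (ENNReal.ofReal (angularKer n σ y) * gammaM1Density n y))
    {g : EuclideanSpace ℝ (Fin n) → ℝ≥0∞} (hg : Measurable g) {lam : ℝ} (hlam : 0 < lam) :
    gammaM1 n {x | ENNReal.ofReal lam < ∫⁻ y, K x y * g y} ≤
      ENNReal.ofReal (C₁ * C₂ / lam) * ∫⁻ y, g y ∂gammaM1 n := by
  have hw := measurable_gammaM1Density n
  have hF : Measurable fun x => ∫⁻ y, K x y * g y :=
    (hK.mul (hg.comp measurable_snd)).lintegral_prod_right'
  have hs : MeasurableSet {x | ENNReal.ofReal lam < ∫⁻ y, K x y * g y} :=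
    measurableSet_lt measurable_const hF
  have hA : Measurable fun p : Metric.sphere (0 : EuclideanSpace ℝ (Fin n)) 1 ×
      EuclideanSpace ℝ (Fin n) => ENNReal.ofReal (angularKer n p.1 p.2) :=
    ((measurable_angularKer n).comp
      ((measurable_subtype_coe.comp measurable_fst).prodMk measurable_snd)).ennreal_ofReal
  have hAwg : Measurable (Function.uncurry fun
      (σ : Metric.sphere (0 : EuclideanSpace ℝ (Fin n)) 1) (y : EuclideanSpace ℝ (Fin n)) =>
        ENNReal.ofReal (angularKer n σ y) * gammaM1Density n y * g y) :=
    (hA.mul (hw.comp measurable_snd)).mul (hg.comp measurable_snd)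
  have hAy : ∀ y : EuclideanSpace ℝ (Fin n), Measurable fun
      σ : Metric.sphere (0 : EuclideanSpace ℝ (Fin n)) 1 => ENNReal.ofReal (angularKer n σ y) :=
    fun y => ((measurable_angularKer n).comp
      (measurable_subtype_coe.prodMk measurable_const)).ennreal_ofReal
  have hray : ∀ σ : Metric.sphere (0 : EuclideanSpace ℝ (Fin n)) 1,
      ENNReal.ofReal (π ^ ((n : ℝ) / 2)) * radialMeasure n
        {r | r • (σ : EuclideanSpace ℝ (Fin n)) ∈ {x | ENNReal.ofReal lam < ∫⁻ y, K x y * g y}} ≤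
      ENNReal.ofReal (C₁ / lam) *
        ∫⁻ y, ENNReal.ofReal (angularKer n σ y) * gammaM1Density n y * g y := by
    intro σ
    have hπ0 : ENNReal.ofReal (π ^ ((n : ℝ) / 2)) ≠ 0 := by
      simpa using Real.rpow_pos_of_pos Real.pi_pos _
    rw [mul_comm, ← ENNReal.le_div_iff_mul_le (Or.inl hπ0) (Or.inl ENNReal.ofReal_ne_top)]
    refine measure_le_of_forall_measure_Iic_le _ _ _ fun ρ hρs => ?_
    rcases le_or_gt ρ 0 with hρ | hρ
    · rw [radialMeasure_Iic_of_nonpos n hρ]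
      exact zero_le
    rw [ENNReal.le_div_iff_mul_le (Or.inl hπ0) (Or.inl ENNReal.ofReal_ne_top), mul_comm]
    have hlam0 : ENNReal.ofReal lam ≠ 0 := by simpa using hlam
    rw [ENNReal.ofReal_div_of_pos hlam, ← ENNReal.mul_div_right_comm,
      ENNReal.le_div_iff_mul_le (Or.inl hlam0) (Or.inl ENNReal.ofReal_ne_top)]
    have hρs' : ENNReal.ofReal lam <
      ∫⁻ y, K (ρ • (σ : EuclideanSpace ℝ (Fin n))) y * g y := hρs
    refine (mul_le_mul_right hρs'.le _).trans ?_
    have hm : Measurable fun y => K (ρ • (σ : EuclideanSpace ℝ (Fin n))) y * g y :=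
      (hK.comp measurable_prodMk_left).mul hg
    rw [← lintegral_const_mul _ hm, ← lintegral_const_mul' _ _ ENNReal.ofReal_ne_top]
    refine lintegral_mono fun y => ?_
    simp only [← mul_assoc]
    refine mul_le_mul_left ?_ _
    simpa only [← mul_assoc] using hpt σ ρ hρ y
  calc gammaM1 n {x | ENNReal.ofReal lam < ∫⁻ y, K x y * g y}
      ≤ ∫⁻ σ, ENNReal.ofReal (C₁ / lam) *
          (∫⁻ y, ENNReal.ofReal (angularKer n σ y) * gammaM1Density n y * g y)
          ∂(volume : Measure (EuclideanSpace ℝ (Fin n))).toSphere := by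
        rw [gammaM1_eq_lintegral n hn hs]
        exact lintegral_mono hray
    _ = ENNReal.ofReal (C₁ / lam) * ∫⁻ y, (∫⁻ σ, ENNReal.ofReal (angularKer n σ y)
          ∂(volume : Measure (EuclideanSpace ℝ (Fin n))).toSphere) * (gammaM1Density n y * g y) := by
        rw [lintegral_const_mul' _ _ ENNReal.ofReal_ne_top, lintegral_lintegral_swap]
        · congr 1
          refine lintegral_congr fun y => ?_
          simp only [mul_assoc]
          rw [lintegral_mul_const _ (hAy y)]
        · exact hAwg.aemeasurable
    _ ≤ ENNReal.ofReal (C₁ / lam) * ∫⁻ y, ENNReal.ofReal C₂ * (gammaM1Density n y * g y) := by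
        gcongr with y
        exact hang y
    _ = ENNReal.ofReal (C₁ * C₂ / lam) * ∫⁻ y, g y ∂gammaM1 n := by
        rw [lintegral_const_mul' _ _ ENNReal.ofReal_ne_top, ← mul_assoc,
          ← ENNReal.ofReal_mul (by positivity), gammaM1_eq_withDensity,
          lintegral_withDensity_eq_lintegral_mul _ hw hg, div_mul_eq_mul_div]
        rfl

/-- The operator
`g ↦ ∫ sup_{t>0} T_t^𝒜(x,y) χ_{Nᶜ}(x,y) g(y) dy`
is of weak type (1,1) with respect to `γ₋₁`. -/
theorem stmt10 (n : ℕ) (hn : 1 ≤ n) :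
    ∃ C : ℝ, 0 < C ∧ ∀ g : EuclideanSpace ℝ (Fin n) → ℝ≥0∞, Measurable g →
      (∫⁻ y, g y ∂gammaM1 n) ≠ ⊤ → ∀ lam : ℝ, 0 < lam →
      gammaM1 n {x | ENNReal.ofReal lam <
          ∫⁻ y, (⨆ (t : ℝ) (_ : 0 < t), ENNReal.ofReal (heatKerA n t x y)) *
            Set.indicator ((localN n)ᶜ) (fun _ => (1 : ℝ≥0∞)) (x, y) * g y ∂volume}
        ≤ ENNReal.ofReal (C / lam) * ∫⁻ y, g y ∂gammaM1 n := by
  obtain ⟨C₁, hC₁, hker⟩ := exists_mul_heatKerA_le n hn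
  obtain ⟨C₂, hC₂, hang⟩ := exists_lintegral_angularKer_le n hn
  refine ⟨C₁ * C₂, by positivity, fun g hg _ lam hlam => ?_⟩
  refine gammaM1_lt_lintegral_le hn hC₁ hang (K := fun x y =>
    (⨆ (t : ℝ) (_ : 0 < t), ENNReal.ofReal (heatKerA n t x y)) *
      Set.indicator ((localN n)ᶜ) (fun _ => (1 : ℝ≥0∞)) (x, y))
    ((measurable_iSup_heatKerA n).mul
      (measurable_const.indicator (isClosed_localN n).measurableSet.compl)) ?_ hg hlam
  intro σ ρ hρ y
  by_cases hN : (ρ • (σ : EuclideanSpace ℝ (Fin n)), y) ∈ localN n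
  · simp [hN]
  · simp only [gammaM1Density, Set.indicator_of_mem (Set.mem_compl hN), mul_one, ENNReal.mul_iSup]
    refine iSup₂_le fun t ht => ?_
    rw [← ENNReal.ofReal_mul (angularKer_nonneg n σ y), ← ENNReal.ofReal_mul hC₁.le]
    refine (mul_le_mul_left (mul_le_mul_right (radialMeasure_Iic_le hn hρ) _) _).trans ?_
    rw [← ENNReal.ofReal_mul (by positivity), ← ENNReal.ofReal_mul (by positivity)]
    refine ENNReal.ofReal_le_ofReal ?_
    have := hker ρ t σ y hρ ht (norm_eq_of_mem_sphere σ) hN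
    calc _ = π ^ ((n : ℝ) / 2) * (2 * ρ ^ n * exp (ρ ^ 2) / (1 + ρ ^ 2) *
          heatKerA n t (ρ • (σ : EuclideanSpace ℝ (Fin n))) y) := by ring
      _ ≤ π ^ ((n : ℝ) / 2) * (C₁ * angularKer n σ y * exp (‖y‖ ^ 2)) := by gcongr
      _ = _ := by ring
end

section
/- Let n ≥ 1 and 1 < p < ∞. The operator g ↦ ∫_{ℝⁿ} sup_{t>0} T_t^𝒜(x,y) χ_{N^c}(x,y) g(y) dy is bounded from L^p(ℝⁿ, γ₋₁) into itself: there exists C > 0 such that for every measurable g : ℝⁿ → [0,∞], ∫_{ℝⁿ} (∫_{ℝⁿ} sup_{t>0} T_t^𝒜(x,y) χ_{N^c}(x,y) g(y) dy)^p γ₋₁(x) dx ≤ C ∫_{ℝⁿ} g(y)^p γ₋₁(y) dy. -/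
open MeasureTheory Real
open scoped ENNReal

lemma exists_one_add_pow_le_exp (n : ℕ) {b : ℝ} (hb : 0 < b) :
    ∃ C : ℝ, 0 < C ∧ ∀ w : ℝ, 0 ≤ w → (1 + w) ^ n ≤ C * Real.exp (b * w) := by
  refine ⟨n.factorial / b ^ n * Real.exp b, by positivity, fun w hw => ?_⟩
  have h := Real.pow_div_factorial_le_exp (b * (1 + w)) (by positivity) n
  rw [mul_pow, div_le_iff₀ (by positivity)] at h
  rw [mul_assoc, ← Real.exp_add, div_mul_eq_mul_div, le_div_iff₀ (by positivity)]
  calc (1 + w) ^ n * b ^ n = b ^ n * (1 + w) ^ n := mul_comm _ _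
    _ ≤ _ := h
    _ = _ := by rw [mul_comm]; congr 2; ring

lemma exists_rpow_neg_half_mul_exp_le (n : ℕ) {c : ℝ} (hc : 0 < c) :
    ∃ C : ℝ, 0 < C ∧ ∀ m d s Q : ℝ, 1 ≤ m → 0 < s → 1 ≤ 2 * (m * d) →
      d ^ 2 / s ≤ Q → m * d - 1 ≤ Q →
      s ^ (-(n : ℝ) / 2) * Real.exp (-(c * Q)) ≤ C * (m ^ n * Real.exp (-(c / 2 * (m * d)))) := by
  obtain ⟨C, hC, h⟩ := exists_one_add_pow_le_exp n (half_pos hc)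
  refine ⟨2 ^ n * C * Real.exp (c / 2), by positivity, fun m d s Q hm hs hmd hQ hQ' => ?_⟩
  have hw : 0 ≤ d ^ 2 / s := by positivity
  have hs1 : s ^ (-(n : ℝ) / 2) ≤ (2 * m * (1 + d ^ 2 / s)) ^ n := by
    have e : s ^ (-(n : ℝ) / 2) = ((s⁻¹) ^ (1 / 2 : ℝ)) ^ n := by
      rw [← Real.rpow_natCast, ← Real.rpow_mul (by positivity), Real.inv_rpow hs.le,
        ← Real.rpow_neg hs.le]
      congr 1; ring
    rw [e]
    refine pow_le_pow_left₀ (by positivity) ?_ n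
    rw [← Real.sqrt_eq_rpow]
    apply Real.sqrt_le_iff.2 ⟨by positivity, ?_⟩
    have h1 : s⁻¹ ≤ (2 * m) ^ 2 * (d ^ 2 / s) := by
      rw [← mul_div_assoc, inv_eq_one_div]
      gcongr
      nlinarith
    refine h1.trans ?_
    rw [mul_pow (2 * m) (1 + d ^ 2 / s)]
    exact mul_le_mul_of_nonneg_left (by nlinarith) (by positivity)
  calc s ^ (-(n : ℝ) / 2) * Real.exp (-(c * Q))
      ≤ (2 * m * (1 + d ^ 2 / s)) ^ n *
        (Real.exp (-(c / 2 * (d ^ 2 / s))) * Real.exp (-(c / 2 * (m * d - 1)))) := by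
        rw [← Real.exp_add]
        gcongr
        nlinarith
    _ ≤ (2 * m) ^ n * (C * Real.exp (c / 2 * (d ^ 2 / s))) *
        (Real.exp (-(c / 2 * (d ^ 2 / s))) * Real.exp (-(c / 2 * (m * d - 1)))) := by
        rw [mul_pow]
        gcongr
        exact h _ hw
    _ = _ := by
        have : Real.exp (-(c / 2 * (m * d - 1))) =
            Real.exp (c / 2) * Real.exp (-(c / 2 * (m * d))) := by
          rw [← Real.exp_add]; congr 1; ring
        rw [this, Real.exp_neg (c / 2 * (d ^ 2 / s)), mul_pow]
        field_simp

/-- Schur's test. -/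
lemma lintegral_rpow_lintegral_mul_le {X : Type*} [MeasurableSpace X] {μ : Measure X} [SFinite μ]
    {p : ℝ} (hp : 1 < p) {W : X → X → ℝ≥0∞} (hW : Measurable (Function.uncurry W)) {A : ℝ≥0∞}
    (h1 : ∀ x, ∫⁻ y, W x y ∂μ ≤ A) (h2 : ∀ y, ∫⁻ x, W x y ∂μ ≤ A)
    {h : X → ℝ≥0∞} (hh : Measurable h) :
    ∫⁻ x, (∫⁻ y, W x y * h y ∂μ) ^ p ∂μ ≤ A ^ p * ∫⁻ y, h y ^ p ∂μ := by
  have hp0 : 0 < p := by linarith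
  set q := p.conjExponent with hq
  have hpq : p.HolderConjugate q := Real.HolderConjugate.conjExponent hp
  have hq0 : 0 < q := hpq.symm.pos
  have hWx : ∀ x, Measurable (W x) := fun x => hW.comp measurable_prodMk_left
  have key : ∀ x, (∫⁻ y, W x y * h y ∂μ) ^ p ≤ A ^ (p - 1) * ∫⁻ y, W x y * h y ^ p ∂μ := by
    intro x
    have H := ENNReal.lintegral_mul_le_Lp_mul_Lq μ hpq.symm (f := fun y => W x y ^ (1 / q))
      (g := fun y => W x y ^ (1 / p) * h y) ((hWx x).pow_const _).aemeasurable
      (((hWx x).pow_const _).mul hh).aemeasurable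
    have e0 : ∀ y, W x y ^ (1 / q) * (W x y ^ (1 / p) * h y) = W x y * h y := by
      intro y
      rw [← mul_assoc, ← ENNReal.rpow_add_of_nonneg _ _ (by positivity) (by positivity),
        one_div, one_div, hpq.symm.inv_add_inv_eq_one, ENNReal.rpow_one]
    have e1 : ∀ y, (W x y ^ (1 / q)) ^ q = W x y := by
      intro y
      rw [← ENNReal.rpow_mul, one_div_mul_cancel hq0.ne', ENNReal.rpow_one]
    have e2 : ∀ y, (W x y ^ (1 / p) * h y) ^ p = W x y * h y ^ p := by
      intro y
      rw [ENNReal.mul_rpow_of_nonneg _ _ hp0.le, ← ENNReal.rpow_mul,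
        one_div_mul_cancel hp0.ne', ENNReal.rpow_one]
    simp only [Pi.mul_apply, e0, e1, e2] at H
    calc (∫⁻ y, W x y * h y ∂μ) ^ p
        ≤ ((∫⁻ y, W x y ∂μ) ^ (1 / q) * (∫⁻ y, W x y * h y ^ p ∂μ) ^ (1 / p)) ^ p := by
          gcongr
      _ = (∫⁻ y, W x y ∂μ) ^ (p - 1) * ∫⁻ y, W x y * h y ^ p ∂μ := by
          rw [ENNReal.mul_rpow_of_nonneg _ _ hp0.le, ← ENNReal.rpow_mul, ← ENNReal.rpow_mul,
            one_div_mul_cancel hp0.ne', ENNReal.rpow_one]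
          congr 2
          rw [hq, Real.conjExponent]
          have : p - 1 ≠ 0 := by linarith
          field_simp
      _ ≤ _ := by
          have : 0 ≤ p - 1 := by linarith
          gcongr
          exact h1 x
  calc ∫⁻ x, (∫⁻ y, W x y * h y ∂μ) ^ p ∂μ
      ≤ ∫⁻ x, A ^ (p - 1) * ∫⁻ y, W x y * h y ^ p ∂μ ∂μ := lintegral_mono key
    _ = A ^ (p - 1) * ∫⁻ x, ∫⁻ y, W x y * h y ^ p ∂μ ∂μ := by
        refine lintegral_const_mul _ ?_
        exact (hW.mul ((hh.pow_const p).comp measurable_snd)).lintegral_prod_right'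
    _ = A ^ (p - 1) * ∫⁻ y, ∫⁻ x, W x y * h y ^ p ∂μ ∂μ := by
        rw [lintegral_lintegral_swap]
        exact (hW.mul ((hh.pow_const p).comp measurable_snd)).aemeasurable
    _ ≤ A ^ (p - 1) * ∫⁻ y, A * h y ^ p ∂μ := by
        gcongr with y
        have hWy : Measurable fun x => W x y := hW.comp measurable_prodMk_right
        rw [lintegral_mul_const _ hWy]
        gcongr
        exact h2 y
    _ = A ^ p * ∫⁻ y, h y ^ p ∂μ := by
        rw [lintegral_const_mul _ (hh.pow_const p), ← mul_assoc]
        congr 1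
        nth_rewrite 2 [← ENNReal.rpow_one A]
        rw [← ENNReal.rpow_add_of_nonneg _ _ (by linarith) zero_le_one, sub_add_cancel]

lemma integrable_exp_neg_mul_norm {E : Type*} [NormedAddCommGroup E] [NormedSpace ℝ E]
    [FiniteDimensional ℝ E] [MeasurableSpace E] [BorelSpace E] (μ : Measure E)
    [μ.IsAddHaarMeasure] {a : ℝ} (ha : 0 < a) :
    Integrable (fun z : E => Real.exp (-(a * ‖z‖))) μ := by
  obtain ⟨C, hC, h⟩ := exists_one_add_pow_le_exp (Module.finrank ℝ E + 1) ha
  have hi := (integrable_one_add_norm (E := E) (μ := μ)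
    (r := ((Module.finrank ℝ E + 1 : ℕ) : ℝ)) (by push_cast; linarith)).const_mul C
  refine hi.mono' (by fun_prop) (Filter.Eventually.of_forall fun z => ?_)
  rw [Real.norm_of_nonneg (by positivity), Real.rpow_neg (by positivity), Real.rpow_natCast,
    Real.exp_neg, ← div_eq_mul_inv, le_div_iff₀ (by positivity), inv_mul_le_iff₀ (by positivity),
    mul_comm]
  exact h _ (norm_nonneg z)

lemma lintegral_pow_mul_exp_neg_mul_norm {E : Type*} [NormedAddCommGroup E] [NormedSpace ℝ E]
    [FiniteDimensional ℝ E] [MeasurableSpace E] [BorelSpace E] (μ : Measure E)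
    [μ.IsAddHaarMeasure] {a m : ℝ} (ha : 0 < a) (hm : 0 < m) :
    ∫⁻ z, ENNReal.ofReal (m ^ Module.finrank ℝ E * Real.exp (-(a * (m * ‖z‖)))) ∂μ =
      ENNReal.ofReal (∫ z, Real.exp (-(a * ‖z‖)) ∂μ) := by
  have e : ∀ z : E, m * ‖z‖ = ‖m • z‖ := fun z => by
    rw [norm_smul, Real.norm_of_nonneg hm.le]
  simp only [e]
  have hi : Integrable (fun z : E => Real.exp (-(a * ‖m • z‖))) μ :=
    (integrable_exp_neg_mul_norm μ ha).comp_smul hm.ne'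
  rw [← ofReal_integral_eq_lintegral_ofReal (hi.const_mul _)
    (Filter.Eventually.of_forall fun z => by positivity), integral_const_mul,
    Measure.integral_comp_smul μ (fun z : E => Real.exp (-(a * ‖z‖))), smul_eq_mul,
    abs_of_pos (by positivity), mul_inv_cancel_left₀ (by positivity)]

/-- In the coordinates `s = (1 - r) / (1 + r)`, `r = e^{-t}`, the exponent of the kernel splits
into a part symmetric in `x` and `y` and the difference `(|x|² - |y|²) / 2`. -/
lemma norm_sub_smul_sq_div {E : Type*} [NormedAddCommGroup E] [InnerProductSpace ℝ E] (x y : E)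
    {r : ℝ} (h0 : 0 < r) (h1 : r < 1) :
    ‖x - r • y‖ ^ 2 / (1 - r ^ 2) =
      ((1 - r) / (1 + r) * ‖x + y‖ ^ 2 + ‖x - y‖ ^ 2 / ((1 - r) / (1 + r))) / 4 +
        (‖x‖ ^ 2 - ‖y‖ ^ 2) / 2 := by
  have e1 : 1 - r ≠ 0 := by linarith
  have e2 : 1 + r ≠ 0 := by linarith
  have e3 : 1 - r ^ 2 = (1 - r) * (1 + r) := by ring
  rw [norm_sub_sq_real, norm_sub_sq_real, norm_add_sq_real, norm_smul, inner_smul_right,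
    Real.norm_of_nonneg h0.le, e3]
  field_simp
  ring

lemma abs_norm_sq_sub_norm_sq_le {E : Type*} [NormedAddCommGroup E] [InnerProductSpace ℝ E]
    (x y : E) : |‖x‖ ^ 2 - ‖y‖ ^ 2| ≤ ‖x + y‖ * ‖x - y‖ := by
  have h : ‖x‖ ^ 2 - ‖y‖ ^ 2 = inner ℝ (x + y) (x - y) := by
    rw [inner_add_left, inner_sub_right, inner_sub_right, real_inner_self_eq_norm_sq,
      real_inner_self_eq_norm_sq, real_inner_comm]
    ring
  rw [h]
  exact abs_real_inner_le_norm _ _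

lemma exp_mul_heatKerA_le (n : ℕ) {p : ℝ} {c : ℝ} (hc : c = (1 - 2 * |1 / p - 1 / 2|) / 4)
    {t : ℝ} (ht : 0 < t) (x y : EuclideanSpace ℝ (Fin n)) :
    ∃ s : ℝ, 0 < s ∧ s < 1 ∧ heatKerA n t x y ≤
      Real.exp (-(‖x‖ ^ 2 / p)) * (s ^ (-(n : ℝ) / 2) *
        Real.exp (-(c * (s * ‖x + y‖ ^ 2 + ‖x - y‖ ^ 2 / s)))) * Real.exp (‖y‖ ^ 2 / p) := by
  set r := Real.exp (-t) with hr
  have h0 : 0 < r := Real.exp_pos _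
  have h1 : r < 1 := by
    rw [hr, Real.exp_lt_one_iff]; linarith
  have hr2 : Real.exp (-2 * t) = r ^ 2 := by
    rw [hr, ← Real.exp_nat_mul]; congr 1; push_cast; ring
  set s := (1 - r) / (1 + r) with hs
  have hs0 : 0 < s := div_pos (by linarith) (by linarith)
  have hs1 : s < 1 := by rw [hs, div_lt_one (by linarith)]; linarith
  refine ⟨s, hs0, hs1, ?_⟩
  have hss : s ≤ 1 - r ^ 2 := by
    rw [hs, div_le_iff₀ (by linarith)]; nlinarith [mul_pos h0 (sub_pos.2 h1)]
  have hn : -(n : ℝ) / 2 ≤ 0 := by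
    have : (0 : ℝ) ≤ n := n.cast_nonneg
    linarith
  have f1 : Real.exp (-(n : ℝ) * t) ≤ 1 := by
    rw [Real.exp_le_one_iff]
    have : (0 : ℝ) ≤ n * t := by positivity
    linarith
  have f2 : Real.pi ^ (-(n : ℝ) / 2) ≤ 1 :=
    Real.rpow_le_one_of_one_le_of_nonpos (by linarith [Real.pi_gt_three]) hn
  have f3 : (1 - r ^ 2) ^ (-(n : ℝ) / 2) ≤ s ^ (-(n : ℝ) / 2) :=
    Real.rpow_le_rpow_of_nonpos hs0 hss hn
  have f4 : Real.exp (-‖x - r • y‖ ^ 2 / (1 - r ^ 2)) ≤ Real.exp (-(‖x‖ ^ 2 / p)) *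
      Real.exp (-(c * (s * ‖x + y‖ ^ 2 + ‖x - y‖ ^ 2 / s))) * Real.exp (‖y‖ ^ 2 / p) := by
    rw [← Real.exp_add, ← Real.exp_add, neg_div, norm_sub_smul_sq_div x y h0 h1, ← hs]
    apply Real.exp_le_exp.2
    set Q := s * ‖x + y‖ ^ 2 + ‖x - y‖ ^ 2 / s with hQ
    have hQ2 : 2 * (‖x + y‖ * ‖x - y‖) ≤ Q := by
      have : 0 ≤ (s * ‖x + y‖ - ‖x - y‖) ^ 2 / s := by positivity
      have e : (s * ‖x + y‖ - ‖x - y‖) ^ 2 / s = Q - 2 * (‖x + y‖ * ‖x - y‖) := by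
        rw [hQ]; field_simp; ring
      linarith
    have h3 := abs_norm_sq_sub_norm_sq_le x y
    have h4 : (1 / p - 1 / 2) * (‖x‖ ^ 2 - ‖y‖ ^ 2) ≤ |1 / p - 1 / 2| * (Q / 2) := by
      refine (le_abs_self _).trans ?_
      rw [abs_mul]
      gcongr
      linarith
    have e1 : ‖x‖ ^ 2 / p = 1 / p * ‖x‖ ^ 2 := by ring
    have e2 : ‖y‖ ^ 2 / p = 1 / p * ‖y‖ ^ 2 := by ring
    rw [e1, e2, hc]
    linarith
  rw [heatKerA, hr2]
  have g1 : 0 ≤ (1 - r ^ 2) ^ (-(n : ℝ) / 2) := Real.rpow_nonneg (hs0.le.trans hss) _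
  calc _ ≤ 1 * 1 * s ^ (-(n : ℝ) / 2) * (Real.exp (-(‖x‖ ^ 2 / p)) *
      Real.exp (-(c * (s * ‖x + y‖ ^ 2 + ‖x - y‖ ^ 2 / s))) * Real.exp (‖y‖ ^ 2 / p)) := by
        gcongr
    _ = _ := by ring

lemma max_one_norm_mul_sub_one_le {E : Type*} [NormedAddCommGroup E] [NormedSpace ℝ E]
    (x y : E) {s : ℝ} (h0 : 0 < s) (h1 : s < 1) :
    max 1 ‖x‖ * ‖x - y‖ - 1 ≤ s * ‖x + y‖ ^ 2 + ‖x - y‖ ^ 2 / s := by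
  set U := ‖x + y‖
  set d := ‖x - y‖
  have hU : 0 ≤ U := norm_nonneg _
  have hd : 0 ≤ d := norm_nonneg _
  have hx : 2 * ‖x‖ ≤ U + d := by
    have := norm_add_le (x + y) (x - y)
    rwa [add_add_sub_cancel, ← two_smul ℝ x, norm_smul, Real.norm_two] at this
  have a1 : d ^ 2 ≤ d ^ 2 / s := by
    rw [le_div_iff₀ h0]; nlinarith [sq_nonneg d]
  have a2 : 2 * (U * d) ≤ s * U ^ 2 + d ^ 2 / s := by
    have : 0 ≤ (s * U - d) ^ 2 / s := by positivity
    have e : (s * U - d) ^ 2 / s = s * U ^ 2 + d ^ 2 / s - 2 * (U * d) := by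
      field_simp; ring
    linarith
  have a3 : 0 ≤ s * U ^ 2 := by positivity
  rcases max_cases 1 ‖x‖ with ⟨h, _⟩ | ⟨h, _⟩ <;> rw [h]
  · nlinarith [sq_nonneg (d - 1)]
  · nlinarith

/-- Outside the local region, up to the Gaussian weights, the kernel is dominated by an
exponential at scale `1 / max(1, |x|)` as well as by one at scale `1 / max(1, |y|)`. -/
lemma exists_heatKerA_le_of_notMem_localN (n : ℕ) {p : ℝ} (hp : 1 < p) :
    ∃ a C : ℝ, 0 < a ∧ 0 < C ∧ ∀ x y : EuclideanSpace ℝ (Fin n), (x, y) ∉ localN n →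
      ∀ t : ℝ, 0 < t → heatKerA n t x y ≤ Real.exp (-(‖x‖ ^ 2 / p)) *
        (C * min (max 1 ‖x‖ ^ n * Real.exp (-(a * (max 1 ‖x‖ * ‖x - y‖))))
          (max 1 ‖y‖ ^ n * Real.exp (-(a * (max 1 ‖y‖ * ‖x - y‖))))) *
        Real.exp (‖y‖ ^ 2 / p) := by
  obtain ⟨c, hc⟩ : ∃ c : ℝ, c = (1 - 2 * |1 / p - 1 / 2|) / 4 := ⟨_, rfl⟩
  have hc0 : 0 < c := by
    have h1 : 1 / p < 1 := by rw [div_lt_one (by linarith)]; exact hp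
    have h2 : 0 < 1 / p := by positivity
    have : |1 / p - 1 / 2| < 1 / 2 := by rw [abs_lt]; constructor <;> linarith
    linarith
  obtain ⟨C, hC, h⟩ := exists_rpow_neg_half_mul_exp_le n hc0
  refine ⟨c / 2, C, half_pos hc0, hC, fun x y hxy t ht => ?_⟩
  obtain ⟨s, hs0, hs1, hs⟩ := exp_mul_heatKerA_le n hc ht x y
  refine hs.trans ?_
  have hd : 0 ≤ ‖x - y‖ := norm_nonneg _
  have hmx : 1 ≤ max 1 ‖x‖ * ‖x - y‖ := by
    by_contra! hlt
    refine hxy ⟨?_, ?_⟩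
    · nlinarith [le_max_left 1 ‖x‖]
    · nlinarith [le_max_right 1 ‖x‖]
  have hmy : 1 ≤ 2 * (max 1 ‖y‖ * ‖x - y‖) := by
    rcases le_total 1 ‖x - y‖ with hd1 | hd1
    · nlinarith [le_max_left 1 ‖y‖]
    · have : max 1 ‖x‖ ≤ 2 * max 1 ‖y‖ := by
        have h1 := norm_le_norm_add_norm_sub' x y
        have h2 := le_max_left 1 ‖y‖
        have h3 := le_max_right 1 ‖y‖
        exact max_le (by linarith) (by linarith)
      nlinarith
  have hQ : ‖x - y‖ ^ 2 / s ≤ s * ‖x + y‖ ^ 2 + ‖x - y‖ ^ 2 / s := by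
    have : 0 ≤ s * ‖x + y‖ ^ 2 := by positivity
    linarith
  have hy := max_one_norm_mul_sub_one_le y x hs0 hs1
  rw [norm_sub_rev y x, add_comm y x] at hy
  refine mul_le_mul_of_nonneg_right (mul_le_mul_of_nonneg_left ?_ (Real.exp_pos _).le)
    (Real.exp_pos _).le
  rw [mul_min_of_nonneg _ _ hC.le]
  exact le_min
    (h _ _ _ _ (le_max_left _ _) hs0 (by linarith) hQ (max_one_norm_mul_sub_one_le x y hs0 hs1))
    (h _ _ _ _ (le_max_left _ _) hs0 hmy hQ hy)

lemma lintegral_gammaM1_ofReal_exp_mul_rpow (n : ℕ) {p : ℝ} (hp : 1 < p)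
    {f : EuclideanSpace ℝ (Fin n) → ℝ≥0∞} (hf : Measurable f) :
    ∫⁻ x, (ENNReal.ofReal (Real.exp (-(‖x‖ ^ 2 / p))) * f x) ^ p ∂gammaM1 n =
      ENNReal.ofReal (Real.pi ^ ((n : ℝ) / 2)) * ∫⁻ x, f x ^ p := by
  have hp0 : 0 < p := by linarith
  rw [gammaM1, lintegral_withDensity_eq_lintegral_mul _ (by fun_prop) (by fun_prop),
    ← lintegral_const_mul _ (hf.pow_const p)]
  refine lintegral_congr fun x => ?_
  rw [Pi.mul_apply, ENNReal.mul_rpow_of_nonneg _ _ hp0.le,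
    ENNReal.ofReal_rpow_of_pos (Real.exp_pos _), ← Real.exp_mul, ← mul_assoc,
    ← ENNReal.ofReal_mul (by positivity), mul_assoc, ← Real.exp_add]
  have : ‖x‖ ^ 2 + -(‖x‖ ^ 2 / p) * p = 0 := by field_simp; ring
  rw [this, Real.exp_zero, mul_one]

/-- For `1 < p < ∞`, the operator
`g ↦ ∫ sup_{t>0} T_t^𝒜(x,y) χ_{Nᶜ}(x,y) g(y) dy` is bounded on `L^p(ℝⁿ, γ₋₁)`. -/
theorem stmt11 (n : ℕ) (hn : 1 ≤ n) (p : ℝ) (hp : 1 < p) :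
    ∃ C : ℝ, 0 < C ∧ ∀ g : EuclideanSpace ℝ (Fin n) → ℝ≥0∞, Measurable g →
      (∫⁻ x, (∫⁻ y, (⨆ (t : ℝ) (_ : 0 < t), ENNReal.ofReal (heatKerA n t x y)) *
            Set.indicator ((localN n)ᶜ) (fun _ => (1 : ℝ≥0∞)) (x, y) * g y ∂volume) ^ p
          ∂gammaM1 n)
        ≤ ENNReal.ofReal C * ∫⁻ y, g y ^ p ∂gammaM1 n := by
  obtain ⟨a, C, ha, hC, hK⟩ := exists_heatKerA_le_of_notMem_localN n hp
  have hp0 : 0 < p := by linarith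
  set k : EuclideanSpace ℝ (Fin n) → EuclideanSpace ℝ (Fin n) → ℝ :=
    fun x z => max 1 ‖x‖ ^ n * Real.exp (-(a * (max 1 ‖x‖ * ‖z‖))) with hk
  set W : EuclideanSpace ℝ (Fin n) → EuclideanSpace ℝ (Fin n) → ℝ≥0∞ :=
    fun x y => ENNReal.ofReal (C * min (k x (x - y)) (k y (x - y))) with hW
  have hWm : Measurable (Function.uncurry W) := by
    simp only [hW, hk, Function.uncurry_def]
    exact (ENNReal.continuous_ofReal.comp (by fun_prop)).measurable
  set I := ∫ z : EuclideanSpace ℝ (Fin n), Real.exp (-(a * ‖z‖)) with hI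
  have hI0 : 0 ≤ I := integral_nonneg fun z => by positivity
  have hkI : ∀ x, ∫⁻ z, ENNReal.ofReal (C * k x z) = ENNReal.ofReal (C * I) := fun x => by
    have := lintegral_pow_mul_exp_neg_mul_norm
      (volume : Measure (EuclideanSpace ℝ (Fin n))) ha (m := max 1 ‖x‖) (by positivity)
    rw [finrank_euclideanSpace_fin] at this
    simp only [ENNReal.ofReal_mul hC.le]
    rw [lintegral_const_mul _ (by fun_prop), this]
  have h1 : ∀ x, ∫⁻ y, W x y ≤ ENNReal.ofReal (C * I) := fun x => by
    rw [← hkI x, ← lintegral_sub_left_eq_self (fun z => ENNReal.ofReal (C * k x z)) x]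
    refine lintegral_mono fun y => ?_
    simp only [hW]
    gcongr
    exact min_le_left _ _
  have h2 : ∀ y, ∫⁻ x, W x y ≤ ENNReal.ofReal (C * I) := fun y => by
    rw [← hkI y, ← lintegral_sub_right_eq_self (fun z => ENNReal.ofReal (C * k y z)) y]
    refine lintegral_mono fun x => ?_
    simp only [hW]
    gcongr
    exact min_le_right _ _
  refine ⟨(C * I) ^ p + 1, by positivity, fun g hg => ?_⟩
  set h : EuclideanSpace ℝ (Fin n) → ℝ≥0∞ :=
    fun y => ENNReal.ofReal (Real.exp (‖y‖ ^ 2 / p)) * g y with hh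
  have hhm : Measurable h := by fun_prop
  have hgh : ∀ y, g y = ENNReal.ofReal (Real.exp (-(‖y‖ ^ 2 / p))) * h y := fun y => by
    rw [hh, ← mul_assoc, ← ENNReal.ofReal_mul (by positivity), ← Real.exp_add, neg_add_cancel,
      Real.exp_zero, ENNReal.ofReal_one, one_mul]
  have hWh : Measurable fun x => ∫⁻ y, W x y * h y :=
    (hWm.mul (hhm.comp measurable_snd)).lintegral_prod_right'
  calc _ ≤ ∫⁻ x, (ENNReal.ofReal (Real.exp (-(‖x‖ ^ 2 / p))) * ∫⁻ y, W x y * h y) ^ p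
        ∂gammaM1 n := by
        refine lintegral_mono fun x => ENNReal.rpow_le_rpow ?_ hp0.le
        rw [← lintegral_const_mul' _ _ ENNReal.ofReal_ne_top]
        refine lintegral_mono fun y => ?_
        by_cases hxy : (x, y) ∈ localN n
        · simp [hxy]
        · rw [Set.indicator_of_mem (Set.mem_compl hxy), mul_one, hh, ← mul_assoc, ← mul_assoc]
          gcongr
          refine iSup₂_le fun t ht => ?_
          rw [← ENNReal.ofReal_mul (by positivity), ← ENNReal.ofReal_mul (by positivity)]
          exact ENNReal.ofReal_le_ofReal (hK x y hxy t ht)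
    _ = ENNReal.ofReal (Real.pi ^ ((n : ℝ) / 2)) * ∫⁻ x, (∫⁻ y, W x y * h y) ^ p :=
        lintegral_gammaM1_ofReal_exp_mul_rpow n hp hWh
    _ ≤ ENNReal.ofReal (Real.pi ^ ((n : ℝ) / 2)) *
        (ENNReal.ofReal (C * I) ^ p * ∫⁻ y, h y ^ p) := by
        gcongr
        exact lintegral_rpow_lintegral_mul_le hp hWm h1 h2 hhm
    _ = ENNReal.ofReal ((C * I) ^ p) * ∫⁻ y, g y ^ p ∂gammaM1 n := by
        rw [mul_left_comm, ENNReal.ofReal_rpow_of_nonneg (by positivity) hp0.le,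
          ← lintegral_gammaM1_ofReal_exp_mul_rpow n hp hhm]
        simp only [← hgh]
    _ ≤ _ := by
        gcongr
        linarith
end
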